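/- arXiv:2106.06961 — 7 statements merged into one kernel-verified Lean document; each statement's English description precedes it below -/
import Mathlib

section
/- Let d be a positive integer and let f be a (d+1)-times continuously differentiable function on [-1,1] with max_{x ∈ [-1,1]} |f(x)| ≥ 1. If f has at least d+1 distinct zeros in [-1,1], then max_{x ∈ [-1,1]} |f^{(d+1)}(x)| ≥ (d+1)!/2^{d+1}. -/
open Set

/-- A finite set of zeros of a differentiable function yields, by Rolle's theorem, a set of zeros
of its derivative with at most one element less. -/
lemma exists_finset_zeros_derivWithin {a b : ℝ} {g : ℝ → ℝ}
    (hg : DifferentiableOn ℝ g (Icc a b)) (Z : Finset ℝ) (hZ : (Z : Set ℝ) ⊆ Icc a b)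
    (hz : ∀ x ∈ Z, g x = 0) :
    ∃ W : Finset ℝ, (W : Set ℝ) ⊆ Icc a b ∧ Z.card ≤ W.card + 1 ∧
      ∀ x ∈ W, derivWithin g (Icc a b) x = 0 := by
  obtain hn | ⟨n, hn⟩ : Z.card = 0 ∨ ∃ n, Z.card = n + 1 := by
    cases h : Z.card <;> simp
  · exact ⟨∅, by simp, by simp [hn], by simp⟩
  let z := Z.orderEmbOfFin hn
  have hzmem (i) : z i ∈ Z := Z.orderEmbOfFin_mem hn i
  have key (i : Fin n) : ∃ c ∈ Ioo (z i.castSucc) (z i.succ),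
      derivWithin g (Icc a b) c = 0 := by
    have hsub : Icc (z i.castSucc) (z i.succ) ⊆ Icc a b :=
      Icc_subset_Icc (hZ (hzmem _)).1 (hZ (hzmem _)).2
    obtain ⟨c, hc, h0⟩ := exists_deriv_eq_zero (f := g) (z.strictMono i.castSucc_lt_succ)
      (hg.continuousOn.mono hsub) (by rw [hz _ (hzmem _), hz _ (hzmem _)])
    refine ⟨c, hc, ?_⟩
    rw [derivWithin_of_mem_nhds, h0]
    exact Filter.mem_of_superset (Icc_mem_nhds hc.1 hc.2) hsub
  choose c hc hc0 using key
  have hmono : StrictMono c := fun i j hij ↦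
    (hc i).2.trans_le <| (z.monotone (Fin.succ_le_castSucc_iff.2 hij)).trans (hc j).1.le
  refine ⟨Finset.univ.map ⟨c, hmono.injective⟩, ?_, by simp [hn], by simpa using hc0⟩
  simp only [Finset.coe_map, Function.Embedding.coeFn_mk, Finset.coe_univ, image_univ]
  rintro _ ⟨i, rfl⟩
  exact ⟨(hZ (hzmem _)).1.trans (hc i).1.le, (hc i).2.le.trans (hZ (hzmem _)).2⟩

/-- **Generalized Rolle theorem**. -/
lemma exists_iteratedDerivWithin_eq_zero {a b : ℝ} (hab : a < b) {n : ℕ} {g : ℝ → ℝ}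
    (hg : ContDiffOn ℝ n g (Icc a b)) (Z : Finset ℝ) (hZ : (Z : Set ℝ) ⊆ Icc a b)
    (hcard : n < Z.card) (hz : ∀ x ∈ Z, g x = 0) :
    ∃ ξ ∈ Icc a b, iteratedDerivWithin n g (Icc a b) ξ = 0 := by
  have key : ∀ k ≤ n, ∃ W : Finset ℝ, (W : Set ℝ) ⊆ Icc a b ∧ Z.card ≤ W.card + k ∧
      ∀ x ∈ W, iteratedDerivWithin k g (Icc a b) x = 0 := by
    intro k
    induction k with
    | zero => exact fun _ ↦ ⟨Z, hZ, le_rfl, by simpa using hz⟩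
    | succ k ih =>
      intro hk
      obtain ⟨W, hW, hWcard, hW0⟩ := ih (by omega)
      obtain ⟨V, hV, hVcard, hV0⟩ := exists_finset_zeros_derivWithin
        (hg.differentiableOn_iteratedDerivWithin (m := k) (by exact_mod_cast hk)
          (uniqueDiffOn_Icc hab)) W hW hW0
      exact ⟨V, hV, by omega, fun x hx ↦ by rw [iteratedDerivWithin_succ, hV0 x hx]⟩
  obtain ⟨W, hW, hWcard, hW0⟩ := key n le_rfl
  obtain ⟨ξ, hξ⟩ := Finset.card_pos.1 (show 0 < W.card by omega)
  exact ⟨ξ, hW hξ, hW0 ξ hξ⟩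

lemma Polynomial.iteratedDerivWithin_eval {s : Set ℝ} (hs : UniqueDiffOn ℝ s) (p : Polynomial ℝ)
    (n : ℕ) {x : ℝ} (hx : x ∈ s) :
    iteratedDerivWithin n (fun t ↦ p.eval t) s x = (Polynomial.derivative^[n] p).eval x := by
  induction n generalizing p x with
  | zero => simp
  | succ n ih =>
    rw [iteratedDerivWithin_succ', Function.iterate_succ_apply, ← ih _ hx]
    exact iteratedDerivWithin_congr (fun y hy ↦ p.derivWithin (hs y hy)) hx

lemma Polynomial.Monic.iterate_derivative_natDegree {R : Type*} [CommSemiring R]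
    {p : Polynomial R} (hp : p.Monic) :
    Polynomial.derivative^[p.natDegree] p = Polynomial.C (p.natDegree.factorial : R) := by
  have h := p.natDegree_iterate_derivative p.natDegree
  rw [Polynomial.eq_C_of_natDegree_le_zero (h.trans (Nat.sub_self _).le),
    Polynomial.coeff_iterate_derivative]
  simp [hp.coeff_natDegree, Nat.descFactorial_self]

/-- The error formula for Lagrange interpolation of a function vanishing at all nodes. -/
lemma exists_eq_iteratedDerivWithin_mul_prod {a b : ℝ} (hab : a < b) {f : ℝ → ℝ} (Z : Finset ℝ)
    (hf : ContDiffOn ℝ Z.card f (Icc a b)) (hZ : (Z : Set ℝ) ⊆ Icc a b)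
    (hz : ∀ x ∈ Z, f x = 0) {x : ℝ} (hx : x ∈ Icc a b) :
    ∃ ξ ∈ Icc a b, Z.card.factorial * f x =
      iteratedDerivWithin Z.card f (Icc a b) ξ * ∏ z ∈ Z, (x - z) := by
  by_cases hxZ : x ∈ Z
  · exact ⟨x, hx, by rw [hz x hxZ, Finset.prod_eq_zero hxZ (sub_self x)]; simp⟩
  let P : Polynomial ℝ := ∏ z ∈ Z, (Polynomial.X - Polynomial.C z)
  have hP (t : ℝ) : P.eval t = ∏ z ∈ Z, (t - z) := by simp [P, Polynomial.eval_prod]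
  have hPdeg : P.natDegree = Z.card := Polynomial.natDegree_finsetProd_X_sub_C_eq_card ..
  have hPmonic : P.Monic := Polynomial.monic_prod_X_sub_C _ _
  have hPx : P.eval x ≠ 0 := by
    rw [hP, Finset.prod_ne_zero_iff]
    exact fun z hzZ h ↦ hxZ (sub_eq_zero.1 h ▸ hzZ)
  set c := f x / P.eval x with hc
  have hPc : ContDiff ℝ Z.card fun t ↦ c * P.eval t := contDiff_const.mul <| by
    simpa using P.contDiff_aeval (𝕜 := ℝ) Z.card
  obtain ⟨ξ, hξ, h0⟩ := exists_iteratedDerivWithin_eq_zero hab (n := Z.card)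
    (g := f - fun t ↦ c * P.eval t) (hf.sub hPc.contDiffOn) (insert x Z)
    (by simpa [insert_subset_iff] using ⟨hx, hZ⟩) (by simp [hxZ]) (by
      intro t ht
      obtain rfl | ht := Finset.mem_insert.1 ht
      · simp [hc, hPx]
      · simp [hz t ht, hP, Finset.prod_eq_zero ht (sub_self t)])
  refine ⟨ξ, hξ, ?_⟩
  have hs := uniqueDiffOn_Icc hab
  have hder : Polynomial.derivative^[Z.card] P = Polynomial.C (Z.card.factorial : ℝ) := by
    rw [← hPdeg, hPmonic.iterate_derivative_natDegree]
  rw [iteratedDerivWithin_sub hξ hs (hf ξ hξ) hPc.contDiffWithinAt,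
    iteratedDerivWithin_const_mul_field, Polynomial.iteratedDerivWithin_eval hs P _ hξ, hder,
    Polynomial.eval_C, sub_eq_zero] at h0
  rw [h0, ← hP, hc]
  field_simp

lemma Real.iSup_prop_eq_ite (p : Prop) [Decidable p] (c : ℝ) : (⨆ _ : p, c) = if p then c else 0 := by
  split_ifs with h <;> simp [h]

theorem stmt0 (d : ℕ) (hd : 1 ≤ d) (f : ℝ → ℝ)
    (hf : ContDiffOn ℝ (d + 1) f (Icc (-1) 1))
    (hsup : 1 ≤ ⨆ x ∈ Icc (-1 : ℝ) 1, |f x|)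
    (Z : Finset ℝ) (hZsub : ↑Z ⊆ Icc (-1 : ℝ) 1)
    (hZcard : d + 1 ≤ Z.card) (hZzero : ∀ x ∈ Z, f x = 0) :
    ((d + 1).factorial : ℝ) / 2 ^ (d + 1) ≤
      ⨆ x ∈ Icc (-1 : ℝ) 1, |iteratedDerivWithin (d + 1) f (Icc (-1) 1) x| := by
  have hlt : (-1 : ℝ) < 1 := by norm_num
  simp_rw [Real.iSup_prop_eq_ite] at hsup ⊢
  obtain ⟨x, hx, hmax⟩ := isCompact_Icc.exists_isMaxOn (nonempty_Icc.2 hlt.le) hf.continuousOn.abs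
  have hfx : 1 ≤ |f x| := by
    refine hsup.trans (ciSup_le fun y ↦ ?_)
    split_ifs with hy
    · exact hmax hy
    · exact abs_nonneg _
  obtain ⟨W, hWZ, hWcard⟩ := Finset.exists_subset_card_eq hZcard
  have hWsub : (W : Set ℝ) ⊆ Icc (-1) 1 := (Finset.coe_subset.2 hWZ).trans hZsub
  obtain ⟨ξ, hξ, h⟩ := exists_eq_iteratedDerivWithin_mul_prod hlt W
    (by rw [hWcard]; exact_mod_cast hf) hWsub (fun z hz ↦ hZzero z (hWZ hz)) hx
  rw [hWcard] at h
  have hprod : |∏ z ∈ W, (x - z)| ≤ 2 ^ (d + 1) := by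
    rw [Finset.abs_prod, ← hWcard, ← Finset.prod_const]
    refine Finset.prod_le_prod (fun _ _ ↦ abs_nonneg _) fun z hz ↦ ?_
    have := hWsub hz
    exact abs_le.2 ⟨by linarith [hx.1, this.2], by linarith [hx.2, this.1]⟩
  have hcont := (hf.continuousOn_iteratedDerivWithin (m := d + 1) (by norm_cast)
    (uniqueDiffOn_Icc hlt)).abs
  obtain ⟨C, hC⟩ := (isCompact_Icc.image_of_continuousOn hcont).bddAbove
  have hbdd : BddAbove (range fun y ↦ if y ∈ Icc (-1 : ℝ) 1 then
      |iteratedDerivWithin (d + 1) f (Icc (-1) 1) y| else 0) := by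
    refine ⟨max C 0, ?_⟩
    rintro _ ⟨y, rfl⟩
    dsimp only
    split_ifs with hy
    · exact le_max_of_le_left (hC (mem_image_of_mem _ hy))
    · exact le_max_right _ _
  refine le_trans ?_ ((if_pos hξ).ge.trans (le_ciSup hbdd ξ))
  rw [div_le_iff₀ (by positivity)]
  calc ((d + 1).factorial : ℝ) ≤ (d + 1).factorial * |f x| :=
        le_mul_of_one_le_right (by positivity) hfx
    _ = |iteratedDerivWithin (d + 1) f (Icc (-1) 1) ξ| * |∏ z ∈ W, (x - z)| := by
        rw [← abs_mul, ← h, abs_mul, Nat.abs_cast]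
    _ ≤ _ := by gcongr
end

section
/- Let d be a positive integer and let f be a (d+1)-times continuously differentiable function on [-1,1] with max_{x ∈ [-1,1]} |f(x)| ≥ 1 and max_{x ∈ [-1,1]} |f^{(d+1)}(x)| < (d+1)!/2^{d+1}. Then f has at most d zeros in [-1,1]. -/
open Set

/-- Generalized Rolle theorem: a `C^n` function on `[a, b]` with `n + 1` distinct zeros there
has a zero of its `n`-th derivative. -/
theorem exists_iteratedDerivWithin_eq_zero_of_card {a b : ℝ} (hab : a < b) (n : ℕ) (g : ℝ → ℝ)
    (hg : ContDiffOn ℝ n g (Icc a b)) (T : Finset ℝ) (hT : ∀ x ∈ T, x ∈ Icc a b ∧ g x = 0)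
    (hcard : T.card = n + 1) :
    ∃ c ∈ Icc a b, iteratedDerivWithin n g (Icc a b) c = 0 := by
  induction n generalizing g T with
  | zero =>
    obtain ⟨x, hx⟩ : T.Nonempty := Finset.card_pos.1 (by omega)
    exact ⟨x, (hT x hx).1, by simpa using (hT x hx).2⟩
  | succ n ih =>
    have hrolle : ∀ x ∈ T, ∀ y ∈ T, x < y →
        ∃ z ∈ Ioo x y, derivWithin g (Icc a b) z = 0 := by
      intro x hx y hy hxy
      obtain ⟨hxI, hx0⟩ := hT x hx
      obtain ⟨hyI, hy0⟩ := hT y hy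
      obtain ⟨z, hz, hz0⟩ := exists_deriv_eq_zero hxy
        (hg.continuousOn.mono (Icc_subset_Icc hxI.1 hyI.2)) (hx0.trans hy0.symm)
      refine ⟨z, hz, ?_⟩
      rw [derivWithin_of_mem_nhds, hz0]
      exact Icc_mem_nhds (hxI.1.trans_lt hz.1) (hz.2.trans_le hyI.2)
    let e := T.orderEmbOfFin hcard
    have he : ∀ i, e i ∈ T := T.orderEmbOfFin_mem hcard
    choose z hz hz0 using fun i : Fin (n + 1) =>
      hrolle _ (he i.castSucc) _ (he i.succ) (e.strictMono i.castSucc_lt_succ)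
    have hzmono : StrictMono z := fun i j hij =>
      (hz i).2.trans_le ((e.monotone (Fin.succ_le_castSucc_iff.2 hij)).trans (hz j).1.le)
    obtain ⟨c, hc, hc0⟩ := ih (derivWithin g (Icc a b))
      (hg.derivWithin (uniqueDiffOn_Icc hab) (by norm_cast)) (Finset.univ.image z)
      (by
        simp only [Finset.mem_image, Finset.mem_univ, true_and, forall_exists_index,
          forall_apply_eq_imp_iff]
        exact fun i => ⟨⟨(hT _ (he _)).1.1.trans (hz i).1.le,
          (hz i).2.le.trans (hT _ (he _)).1.2⟩, hz0 i⟩)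
      (by simp [Finset.card_image_of_injective _ hzmono.injective])
    exact ⟨c, hc, by rwa [iteratedDerivWithin_succ']⟩

theorem iteratedDerivWithin_polynomial_eval {s : Set ℝ} (hs : UniqueDiffOn ℝ s)
    (p : Polynomial ℝ) (n : ℕ) {x : ℝ} (hx : x ∈ s) :
    iteratedDerivWithin n (fun y => p.eval y) s x = (Polynomial.derivative^[n] p).eval x := by
  induction n generalizing p with
  | zero => simp
  | succ n ih =>
    rw [iteratedDerivWithin_succ', Function.iterate_succ_apply, ← ih]
    exact iteratedDerivWithin_congr (fun y hy => p.derivWithin (hs y hy)) hx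

/-- The interpolation error formula for a function vanishing on the nodes `T`. -/
theorem exists_mul_factorial_eq_prod_mul_iteratedDerivWithin {a b : ℝ} (hab : a < b) (n : ℕ)
    (f : ℝ → ℝ) (hf : ContDiffOn ℝ n f (Icc a b)) (T : Finset ℝ)
    (hT : ∀ x ∈ T, x ∈ Icc a b ∧ f x = 0) (hcard : T.card = n) {y : ℝ} (hy : y ∈ Icc a b) :
    ∃ c ∈ Icc a b, f y * n.factorial =
      (∏ x ∈ T, (y - x)) * iteratedDerivWithin n f (Icc a b) c := by
  have hs := uniqueDiffOn_Icc hab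
  by_cases hyT : y ∈ T
  · exact ⟨y, hy, by simp [(hT y hyT).2, Finset.prod_eq_zero hyT (sub_self y)]⟩
  let p : Polynomial ℝ := ∏ x ∈ T, (Polynomial.X - Polynomial.C x)
  have hp : ∀ t, p.eval t = ∏ x ∈ T, (t - x) := fun t => by simp [p, Polynomial.eval_prod]
  have hpC : ContDiff ℝ n (fun t => p.eval t) := by simpa using p.contDiff_aeval (𝕜 := ℝ) n
  obtain ⟨c, hc, hc0⟩ := exists_iteratedDerivWithin_eq_zero_of_card hab n
    ((fun t => p.eval y * f t) - fun t => f y * p.eval t)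
    ((contDiffOn_const.mul hf).sub (contDiffOn_const.mul hpC.contDiffOn)) (insert y T)
    (by
      intro x hx
      rcases Finset.mem_insert.1 hx with rfl | hx
      · exact ⟨hy, by simp [mul_comm]⟩
      · exact ⟨(hT x hx).1, by simp [(hT x hx).2, hp x, Finset.prod_eq_zero hx (sub_self x)]⟩)
    (by rw [Finset.card_insert_of_notMem hyT, hcard])
  refine ⟨c, hc, ?_⟩
  rw [iteratedDerivWithin_sub hc hs (contDiffOn_const.mul hf c hc)
    (contDiff_const.mul hpC).contDiffWithinAt, iteratedDerivWithin_const_mul_field,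
    iteratedDerivWithin_const_mul_field, iteratedDerivWithin_polynomial_eval hs p n hc,
    Polynomial.iterate_derivative_prod_X_sub_C hcard.ge] at hc0
  simp only [hcard, tsub_self, Finset.powersetCard_zero, Finset.sum_singleton, Finset.prod_empty,
    mul_one, Polynomial.eval_natCast] at hc0
  rw [← hp]
  linarith

theorem abs_le_biSup_abs_of_continuousOn {s : Set ℝ} (hs : IsCompact s) {h : ℝ → ℝ}
    (hh : ContinuousOn h s) {x : ℝ} (hx : x ∈ s) : |h x| ≤ ⨆ y ∈ s, |h y| := by
  obtain ⟨C, hC⟩ := hs.exists_bound_of_continuousOn hh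
  refine le_ciSup_of_le ⟨C, ?_⟩ x (ciSup_pos (f := fun _ => |h x|) hx).ge
  rintro _ ⟨y, rfl⟩
  have hC0 : 0 ≤ C := (norm_nonneg _).trans (hC x hx)
  exact Real.iSup_le (fun hy => hC y hy) hC0

theorem stmt3 (d : ℕ) (hd : 1 ≤ d) (f : ℝ → ℝ)
    (hf : ContDiffOn ℝ (d + 1) f (Icc (-1) 1))
    (hsup : 1 ≤ ⨆ x ∈ Icc (-1 : ℝ) 1, |f x|)
    (hder : (⨆ x ∈ Icc (-1 : ℝ) 1, |iteratedDerivWithin (d + 1) f (Icc (-1) 1) x|) <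
      ((d + 1).factorial : ℝ) / 2 ^ (d + 1)) :
    {x ∈ Icc (-1 : ℝ) 1 | f x = 0}.Finite ∧ {x ∈ Icc (-1 : ℝ) 1 | f x = 0}.ncard ≤ d := by
  rw [← encard_le_coe_iff_finite_ncard_le]
  by_contra! hlt
  obtain ⟨S, hS, hScard⟩ := exists_subset_encard_eq (Order.add_one_le_of_lt hlt)
  have hSfin : S.Finite := finite_of_encard_eq_coe (k := d + 1) (by exact_mod_cast hScard)
  lift S to Finset ℝ using hSfin
  have hcard : S.card = d + 1 := by
    rw [encard_coe_eq_coe_finsetCard] at hScard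
    exact_mod_cast hScard
  have hf' : ContDiffOn ℝ (d + 1 : ℕ) f (Icc (-1) 1) := by exact_mod_cast hf
  have hlt' : (-1 : ℝ) < 1 := by norm_num
  obtain ⟨y, hy, hymax⟩ := isCompact_Icc.exists_isMaxOn (nonempty_Icc.2 hlt'.le)
    hf.continuousOn.abs
  have hy1 : 1 ≤ |f y| := hsup.trans <| Real.iSup_le
    (fun x => Real.iSup_le (fun hx => hymax hx) (abs_nonneg _)) (abs_nonneg _)
  obtain ⟨c, hc, hfc⟩ := exists_mul_factorial_eq_prod_mul_iteratedDerivWithin hlt' (d + 1) f hf' S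
    (fun x hx => hS hx) hcard hy
  have hderc := (abs_le_biSup_abs_of_continuousOn isCompact_Icc
    (hf'.continuousOn_iteratedDerivWithin le_rfl (uniqueDiffOn_Icc hlt')) hc).trans_lt hder
  have hprod : |∏ x ∈ S, (y - x)| ≤ 2 ^ (d + 1) := by
    rw [Finset.abs_prod, ← hcard, ← Finset.prod_const]
    refine Finset.prod_le_prod (fun _ _ => abs_nonneg _) fun x hx => ?_
    obtain ⟨⟨hx1, hx2⟩, -⟩ := hS hx
    rw [abs_le]
    constructor <;> linarith [hy.1, hy.2]
  have habs := congrArg abs hfc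
  rw [abs_mul, abs_mul, Nat.abs_cast] at habs
  rw [lt_div_iff₀ (by positivity)] at hderc
  have hfact : (0 : ℝ) < (d + 1).factorial := by positivity
  nlinarith [mul_le_mul_of_nonneg_right hprod
    (abs_nonneg (iteratedDerivWithin (d + 1) f (Icc (-1) 1) c))]
end

section
/- Let d be a positive integer, let B^n be the closed unit ball in R^n, and let Z ⊆ B^n be a set with non-empty interior. Then for every C^{d+1} function f on B^n that vanishes on Z and satisfies M_0(f) = 1, one has M_{d+1}(f) ≥ (d+1)!/2^{d+1}. -/
open Metric

/-- `Mder n l f` : the maximum over the closed unit ball of the sum of absolute values of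
all partial derivatives of order `l` of `f`. -/
noncomputable def Mder (n l : ℕ) (f : EuclideanSpace ℝ (Fin n) → ℝ) : ℝ :=
  ⨆ z ∈ closedBall (0 : EuclideanSpace ℝ (Fin n)) 1,
    ∑ m : Fin l → Fin n,
      |iteratedFDerivWithin ℝ l f (closedBall 0 1) z (fun i => EuclideanSpace.single (m i) 1)|

/-- The iterated derivative of a function restricted to a line is its iterated Fréchet derivative
evaluated on the direction of the line. -/
theorem iteratedDeriv_comp_line {E F : Type*} [NormedAddCommGroup E] [NormedSpace ℝ E]
    [NormedAddCommGroup F] [NormedSpace ℝ F] {f : E → F} {U : Set E} {k : ℕ} {x v : E} {t : ℝ}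
    (hU : IsOpen U) (hf : ContDiffOn ℝ k f U) (ht : x + t • v ∈ U) :
    iteratedDeriv k (fun s : ℝ => f (x + s • v)) t =
      iteratedFDeriv ℝ k f (x + t • v) (fun _ => v) := by
  let A : ℝ →L[ℝ] E := (ContinuousLinearMap.id ℝ ℝ).smulRight v
  let V : Set E := (fun y => x + y) ⁻¹' U
  have hV : IsOpen V := hU.preimage (by fun_prop)
  have hAV : IsOpen (A ⁻¹' V) := hV.preimage A.continuous
  have hF : ContDiffOn ℝ k (fun y => f (x + y)) V :=
    hf.comp (by fun_prop) fun _ hy => hy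
  have hAt : A t ∈ V := ht
  have h := A.iteratedFDerivWithin_comp_right hF hV.uniqueDiffOn hAV.uniqueDiffOn hAt le_rfl
  rw [iteratedFDerivWithin_of_isOpen k hAV hAt, iteratedFDerivWithin_of_isOpen k hV hAt,
    iteratedFDeriv_comp_add_left] at h
  have h' := congrArg (fun T => T fun _ => (1 : ℝ)) h
  simpa [A, iteratedDeriv_eq_iteratedFDeriv, Function.comp_def] using h'

/-- A multilinear form on Euclidean space is controlled on the diagonal by the sum of the absolute
values of its coefficients. -/
theorem ContinuousMultilinearMap.abs_apply_diag_le_sum {n k : ℕ}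
    (T : ContinuousMultilinearMap ℝ (fun _ : Fin k => EuclideanSpace ℝ (Fin n)) ℝ)
    (v : EuclideanSpace ℝ (Fin n)) :
    |T fun _ => v| ≤
      ‖v‖ ^ k * ∑ m : Fin k → Fin n, |T fun i => EuclideanSpace.single (m i) 1| := by
  have hv : v = ∑ j, v j • EuclideanSpace.single j (1 : ℝ) := by
    simpa using ((EuclideanSpace.basisFun (Fin n) ℝ).sum_repr v).symm
  have hT : (T fun _ => v) = ∑ m : Fin k → Fin n,
      (∏ i, v (m i)) * T fun i => EuclideanSpace.single (m i) 1 := by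
    conv_lhs => rw [hv]
    rw [T.map_sum]
    simp only [T.map_smul_univ, smul_eq_mul]
  rw [hT, Finset.mul_sum]
  refine (Finset.abs_sum_le_sum_abs _ _).trans (Finset.sum_le_sum fun m _ => ?_)
  rw [abs_mul, Finset.abs_prod]
  gcongr
  calc ∏ i, |v (m i)| ≤ ∏ _i : Fin k, ‖v‖ :=
        Finset.prod_le_prod (fun _ _ => abs_nonneg _) fun i _ => PiLp.norm_apply_le v (m i)
    _ = ‖v‖ ^ k := by simp

theorem uniqueDiffOn_closedBall_one (n : ℕ) :
    UniqueDiffOn ℝ (closedBall (0 : EuclideanSpace ℝ (Fin n)) 1) :=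
  uniqueDiffOn_convex (convex_closedBall _ _)
    ⟨0, ball_subset_interior_closedBall (mem_ball_self one_pos)⟩

theorem continuousOn_sum_abs_partials {n l : ℕ} {f : EuclideanSpace ℝ (Fin n) → ℝ}
    (hf : ContDiffOn ℝ l f (closedBall 0 1)) :
    ContinuousOn (fun z => ∑ m : Fin l → Fin n,
      |iteratedFDerivWithin ℝ l f (closedBall 0 1) z (fun i => EuclideanSpace.single (m i) 1)|)
      (closedBall 0 1) := by
  have h := hf.continuousOn_iteratedFDerivWithin le_rfl (uniqueDiffOn_closedBall_one n)
  refine continuousOn_finsetSum _ fun m _ => ContinuousOn.abs ?_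
  exact (ContinuousMultilinearMap.apply ℝ _ ℝ _).continuous.comp_continuousOn h

theorem sum_abs_partials_le_Mder {n l : ℕ} {f : EuclideanSpace ℝ (Fin n) → ℝ}
    (hf : ContDiffOn ℝ l f (closedBall 0 1)) {z : EuclideanSpace ℝ (Fin n)}
    (hz : z ∈ closedBall 0 1) :
    ∑ m : Fin l → Fin n,
      |iteratedFDerivWithin ℝ l f (closedBall 0 1) z (fun i => EuclideanSpace.single (m i) 1)| ≤
      Mder n l f := by
  obtain ⟨C, hC⟩ :=
    (isCompact_closedBall _ _).bddAbove_image (continuousOn_sum_abs_partials hf)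
  have hC' := fun y (hy : y ∈ closedBall 0 1) => hC (Set.mem_image_of_mem _ hy)
  have hC0 : 0 ≤ C := (Finset.sum_nonneg fun _ _ => abs_nonneg _).trans (hC' z hz)
  have hbdd : BddAbove (Set.range fun y => ⨆ _ : y ∈ closedBall (0 : EuclideanSpace ℝ (Fin n)) 1,
      ∑ m : Fin l → Fin n, |iteratedFDerivWithin ℝ l f (closedBall 0 1) y
        (fun i => EuclideanSpace.single (m i) 1)|) := by
    refine ⟨C, ?_⟩
    rintro _ ⟨y, rfl⟩
    exact Real.iSup_le (fun hy => hC' y hy) hC0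
  refine le_trans ?_ (le_ciSup hbdd z)
  simp only [hz, ciSup_unique, le_refl]

/-- The maximum of `|f|` over the closed unit ball is attained. -/
theorem exists_Mder_zero_le_abs {n : ℕ} {f : EuclideanSpace ℝ (Fin n) → ℝ}
    (hf : ContinuousOn f (closedBall 0 1)) :
    ∃ z ∈ closedBall (0 : EuclideanSpace ℝ (Fin n)) 1, Mder n 0 f ≤ |f z| := by
  obtain ⟨z, hz, hmax⟩ := (isCompact_closedBall (0 : EuclideanSpace ℝ (Fin n)) 1).exists_isMaxOn
    ⟨0, mem_closedBall_self zero_le_one⟩ hf.abs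
  refine ⟨z, hz, Real.iSup_le (fun y => Real.iSup_le (fun hy => ?_) (abs_nonneg _))
    (abs_nonneg _)⟩
  simpa using hmax hy

/-- **Taylor's theorem** for a function which vanishes near the base point. -/
theorem exists_eq_iteratedDeriv_of_eventuallyEq_zero {g : ℝ → ℝ} {k : ℕ}
    (hg : ContDiffOn ℝ (k + 1) g (Set.Icc 0 1)) (h0 : g =ᶠ[nhds 0] 0) :
    ∃ t ∈ Set.Ioo (0 : ℝ) 1, g 1 = iteratedDeriv (k + 1) g t / (k + 1).factorial := by
  obtain ⟨t, ht, h⟩ := taylor_mean_remainder_lagrange_iteratedDeriv (f := g) (n := k)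
    (zero_ne_one (α := ℝ)) (by rwa [Set.uIcc_of_le zero_le_one])
  refine ⟨t, by simpa [Set.uIoo_of_le] using ht, ?_⟩
  have hT : taylorWithinEval g k (Set.uIcc 0 1) 0 1 = 0 := by
    rw [taylor_within_apply]
    refine Finset.sum_eq_zero fun j _ => ?_
    rw [(h0.filter_mono nhdsWithin_le_nhds).iteratedDerivWithin_eq h0.self_of_nhds]
    simp [Pi.zero_def]
  rw [hT] at h
  simpa using h

theorem stmt4 (n d : ℕ) (hn : 1 ≤ n) (hd : 1 ≤ d)
    (Z : Set (EuclideanSpace ℝ (Fin n)))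
    (hZsub : Z ⊆ closedBall 0 1) (hZint : (interior Z).Nonempty)
    (f : EuclideanSpace ℝ (Fin n) → ℝ)
    (hf : ContDiffOn ℝ (d + 1) f (closedBall 0 1))
    (hzero : ∀ z ∈ Z, f z = 0) (hM0 : Mder n 0 f = 1) :
    ((d + 1).factorial : ℝ) / 2 ^ (d + 1) ≤ Mder n (d + 1) f := by
  obtain ⟨x, hx⟩ := hZint
  obtain ⟨z, hz, hfz⟩ := exists_Mder_zero_le_abs hf.continuousOn
  rw [hM0] at hfz
  have hxball : x ∈ interior (closedBall (0 : EuclideanSpace ℝ (Fin n)) 1) :=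
    interior_mono hZsub hx
  have hmem : ∀ t ∈ Set.Icc (0 : ℝ) 1, x + t • (z - x) ∈ closedBall 0 1 := fun t ht =>
    (convex_closedBall _ _).add_smul_sub_mem (interior_subset hxball) hz ht
  have hcont : Continuous fun t : ℝ => x + t • (z - x) := by fun_prop
  have hg : ContDiffOn ℝ (d + 1) (fun t : ℝ => f (x + t • (z - x))) (Set.Icc 0 1) :=
    hf.comp (by fun_prop) hmem
  have hg0 : (fun t : ℝ => f (x + t • (z - x))) =ᶠ[nhds 0] 0 := by
    have : interior Z ∈ nhds (x + (0 : ℝ) • (z - x)) := by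
      simpa using isOpen_interior.mem_nhds hx
    filter_upwards [hcont.continuousAt.preimage_mem_nhds this] with t ht
    exact hzero _ (interior_subset ht)
  obtain ⟨t, ht, hgt⟩ := exists_eq_iteratedDeriv_of_eventuallyEq_zero hg hg0
  have htint : x + t • (z - x) ∈ interior (closedBall 0 1) := by
    have := (convex_closedBall (0 : EuclideanSpace ℝ (Fin n)) 1).add_smul_sub_mem_interior hz
      hxball (t := 1 - t) ⟨by linarith [ht.2], by linarith [ht.1]⟩
    convert this using 1
    module
  have hf' : ContDiffOn ℝ ((d + 1 : ℕ) : WithTop ℕ∞) f (closedBall 0 1) := by exact_mod_cast hf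
  have hnhds : interior (closedBall 0 1) =ᶠ[nhds (x + t • (z - x))] closedBall 0 1 :=
    Filter.eventuallyEq_set.2 <| Filter.mem_of_superset (isOpen_interior.mem_nhds htint)
      fun y hy => ⟨fun h => interior_subset h, fun _ => hy⟩
  rw [iteratedDeriv_comp_line isOpen_interior (hf'.mono interior_subset) htint,
    ← iteratedFDerivWithin_of_isOpen (d + 1) isOpen_interior htint,
    iteratedFDerivWithin_congr_set (t := closedBall 0 1) hnhds] at hgt
  have hnorm : ‖z - x‖ ≤ 2 := by
    have hx1 : ‖x‖ ≤ 1 := by simpa using interior_subset hxball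
    have hz1 : ‖z‖ ≤ 1 := by simpa using hz
    linarith [norm_sub_le z x]
  have hsum := sum_abs_partials_le_Mder hf' (interior_subset htint)
  have hM : 0 ≤ Mder n (d + 1) f := (Finset.sum_nonneg fun _ _ => abs_nonneg _).trans hsum
  have hfact : (0 : ℝ) < (d + 1).factorial := by positivity
  simp only [one_smul, add_sub_cancel] at hgt
  rw [hgt, abs_div, abs_of_pos hfact, le_div_iff₀ hfact, one_mul] at hfz
  rw [div_le_iff₀' (by positivity)]
  calc ((d + 1).factorial : ℝ) ≤ _ := hfz
    _ ≤ _ := ContinuousMultilinearMap.abs_apply_diag_le_sum _ _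
    _ ≤ 2 ^ (d + 1) * Mder n (d + 1) f := by gcongr
end

section
/- For all positive integers n and d there exists a constant C(n,d) with the following property: for every C^d function f on the closed unit ball B^n ⊂ R^n with M_0(f) = 1 and M_d(f) ≤ 2^{-d-1}, the zero set Y = {x ∈ B^n : f(x) = 0} has (n-1)-dimensional Hausdorff measure at most C(n,d). -/
open Metric MeasureTheory
open scoped ENNReal

/-- `NonvanishingPartials U k g` : all partial derivatives of `g` of order at most `k` exist and are
continuous on `U`, and those of order exactly `k` vanish nowhere on `U`. -/
def NonvanishingPartials {n : ℕ} (U : Set (Fin n → ℝ)) : ℕ → ((Fin n → ℝ) → ℝ) → Prop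
  | 0, g => ContinuousOn g U ∧ ∀ y ∈ U, g y ≠ 0
  | k + 1, g => ContinuousOn g U ∧ ∃ g' : Fin n → (Fin n → ℝ) → ℝ,
      (∀ j, ∀ y ∈ U, HasDerivAt (fun t => g (Function.update y j t)) (g' j y) (y j)) ∧
      ∀ j, NonvanishingPartials U k (g' j)

lemma NonvanishingPartials.continuousOn {n k : ℕ} {U : Set (Fin n → ℝ)} {g : (Fin n → ℝ) → ℝ}
    (h : NonvanishingPartials U k g) : ContinuousOn g U := by
  cases k <;> exact h.1

lemma update_mem_of_convex {n : ℕ} {U : Set (Fin n → ℝ)} (hU : Convex ℝ U) (c : Fin n → ℝ)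
    (j : Fin n) {a b t : ℝ} (ha : Function.update c j a ∈ U) (hb : Function.update c j b ∈ U)
    (hat : a ≤ t) (htb : t ≤ b) : Function.update c j t ∈ U := by
  have hcv : Convex ℝ ((fun t : ℝ => Function.update c j t) ⁻¹' U) := by
    have h : (fun t : ℝ => Function.update c j t) =
        AffineMap.lineMap (k := ℝ) (Function.update c j 0) (Function.update c j 1) := by
      ext t i
      by_cases hi : i = j
      · subst hi; simp [AffineMap.lineMap_apply]
      · simp [AffineMap.lineMap_apply, hi]
    rw [h]
    exact hU.affine_preimage _
  exact hcv.ordConnected.out ha hb ⟨hat, htb⟩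

/-- Iterated Rolle theorem on a line parallel to a coordinate axis. -/
lemma NonvanishingPartials.not_zeros_on_line {n : ℕ} {U : Set (Fin n → ℝ)} (hU : Convex ℝ U)
    (c : Fin n → ℝ) (j : Fin n) (k : ℕ) :
    ∀ g : (Fin n → ℝ) → ℝ, NonvanishingPartials U k g → ∀ z : Fin (k + 1) → ℝ, StrictMono z →
      ¬ ∀ i, Function.update c j (z i) ∈ U ∧ g (Function.update c j (z i)) = 0 := by
  induction k with
  | zero => exact fun g hg z _ h => hg.2 _ (h 0).1 (h 0).2
  | succ k ih =>
    rintro g ⟨_, g', hg', hk⟩ z hz h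
    have hderiv (t : ℝ) (ht : Function.update c j t ∈ U) :
        HasDerivAt (fun t => g (Function.update c j t)) (g' j (Function.update c j t)) t := by
      simpa using hg' j _ ht
    have hmem (i : Fin (k + 1)) (t : ℝ) (h₁ : z i.castSucc ≤ t) (h₂ : t ≤ z i.succ) :
        Function.update c j t ∈ U :=
      update_mem_of_convex hU c j (h _).1 (h _).1 h₁ h₂
    have hroll (i : Fin (k + 1)) : ∃ w ∈ Set.Ioo (z i.castSucc) (z i.succ),
        g' j (Function.update c j w) = 0 := by
      refine exists_hasDerivAt_eq_zero (f := fun t => g (Function.update c j t))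
        (hz (Fin.castSucc_lt_succ)) ?_ ((h _).2.trans (h _).2.symm) ?_
      · exact fun t ht => (hderiv t (hmem i t ht.1 ht.2)).continuousAt.continuousWithinAt
      · exact fun t ht => hderiv t (hmem i t ht.1.le ht.2.le)
    choose w hw hw0 using hroll
    refine ih (g' j) (hk j) w ?_ fun i => ⟨hmem i _ (hw i).1.le (hw i).2.le, hw0 i⟩
    refine Fin.strictMono_iff_lt_succ.2 fun i => ?_
    exact (hw i.castSucc).2.trans (by simpa using (hw i.succ).1)

lemma NonvanishingPartials.card_zeros_on_line_le {n k : ℕ} {U : Set (Fin n → ℝ)}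
    (hU : Convex ℝ U) {g : (Fin n → ℝ) → ℝ} (hg : NonvanishingPartials U k g) (c : Fin n → ℝ)
    (j : Fin n) (s : Finset ℝ)
    (hs : ∀ t ∈ s, Function.update c j t ∈ U ∧ g (Function.update c j t) = 0) : s.card ≤ k := by
  by_contra! h
  obtain ⟨s', hs', hcard⟩ := Finset.exists_subset_card_eq (Nat.succ_le_of_lt h)
  exact hg.not_zeros_on_line hU c j k g (s'.orderEmbOfFin hcard) (OrderEmbedding.strictMono _)
    fun i => hs _ (hs' (Finset.orderEmbOfFin_mem s' hcard i))

/-- A function without critical points in a box that vanishes in the box vanishes on an edge of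
the box. -/
lemma exists_zero_on_edge {n : ℕ} {a b : Fin n → ℝ} (hab : ∀ i, a i < b i) (hn : 1 ≤ n)
    {g : (Fin n → ℝ) → ℝ} (hg : ContinuousOn g (Set.Icc a b)) {g' : Fin n → (Fin n → ℝ) → ℝ}
    (hderiv : ∀ j, ∀ y ∈ Set.Icc a b,
      HasDerivAt (fun t => g (Function.update y j t)) (g' j y) (y j))
    (hne : ∀ j, ∀ y ∈ Set.Icc a b, g' j y ≠ 0) {z : Fin n → ℝ} (hz : z ∈ Set.Icc a b)
    (hgz : g z = 0) :
    ∃ (j : Fin n) (c : Fin n → ℝ), (∀ i, c i = a i ∨ c i = b i) ∧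
      ∃ t ∈ Set.Icc (a j) (b j), g (Function.update c j t) = 0 := by
  have hle (i : Fin n) := (hab i).le
  have hupd (y : Fin n → ℝ) (hy : y ∈ Set.Icc a b) (j : Fin n) (t : ℝ)
      (ht : t ∈ Set.Icc (a j) (b j)) : Function.update y j t ∈ Set.Icc a b := by
    rw [← Set.pi_univ_Icc] at hy ⊢
    exact (Set.update_mem_pi_iff_of_mem hy).2 fun _ => ht
  have hvert (y : Fin n → ℝ) (hy : y ∈ Set.Icc a b)
      (hext : (∀ x ∈ Set.Icc a b, g y ≤ g x) ∨ ∀ x ∈ Set.Icc a b, g x ≤ g y) (i : Fin n) :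
      y i = a i ∨ y i = b i := by
    by_contra! hcon
    have hi : y i ∈ Set.Ioo (a i) (b i) :=
      ⟨lt_of_le_of_ne (hy.1 i) hcon.1.symm, lt_of_le_of_ne (hy.2 i) hcon.2⟩
    have hloc : IsLocalExtr (fun t => g (Function.update y i t)) (y i) := by
      rcases hext with h | h
      · left
        filter_upwards [Ioo_mem_nhds hi.1 hi.2] with t ht
        simpa using h _ (hupd y hy i t ⟨ht.1.le, ht.2.le⟩)
      · right
        filter_upwards [Ioo_mem_nhds hi.1 hi.2] with t ht
        simpa using h _ (hupd y hy i t ⟨ht.1.le, ht.2.le⟩)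
    exact hne i y hy (hloc.hasDerivAt_eq_zero (hderiv i y hy))
  have hcomp : IsCompact (Set.Icc a b) := isCompact_Icc
  obtain ⟨p, hp, hpmin⟩ := hcomp.exists_isMinOn ⟨z, hz⟩ hg
  obtain ⟨q, hq, hqmax⟩ := hcomp.exists_isMaxOn ⟨z, hz⟩ hg
  have hpv := hvert p hp (Or.inl fun x hx => hpmin hx)
  have hqv := hvert q hq (Or.inr fun x hx => hqmax hx)
  have hgp : g p ≤ 0 := hgz ▸ hpmin hz
  have hgq : 0 ≤ g q := hgz ▸ hqmax hz
  by_contra! hno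
  have hends (c : Fin n → ℝ) (hc : ∀ i, c i = a i ∨ c i = b i) : c ∈ Set.Icc a b :=
    ⟨fun i => by rcases hc i with h | h <;> rw [h]; exact hle i,
     fun i => by rcases hc i with h | h <;> rw [h]; exact hle i⟩
  have hneg (s : Finset (Fin n)) : g (s.piecewise q p) < 0 := by
    induction s using Finset.induction_on with
    | empty =>
      refine lt_of_le_of_ne (by simpa using hgp) ?_
      simpa using hno ⟨0, hn⟩ p hpv (p ⟨0, hn⟩) ⟨hp.1 _, hp.2 _⟩
    | insert i s his ih =>
      set c := s.piecewise q p with hc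
      have hcv (i : Fin n) : c i = a i ∨ c i = b i := by
        by_cases h : i ∈ s
        · simpa [hc, h] using hqv i
        · simpa [hc, h] using hpv i
      have hcI := hends c hcv
      rw [Finset.piecewise_insert]
      by_contra! hpos
      have hcont : ContinuousOn (fun t => g (Function.update c i t)) (Set.Icc (a i) (b i)) :=
        hg.comp (Continuous.continuousOn (by fun_prop)) fun t ht => hupd c hcI i t ht
      have hpre : IsPreconnected (Set.Icc (a i) (b i)) := isPreconnected_Icc
      obtain ⟨t, ht, ht0⟩ := hpre.intermediate_value (a := c i) (b := q i)
        ⟨hcI.1 i, hcI.2 i⟩ ⟨hq.1 i, hq.2 i⟩ hcont (show (0 : ℝ) ∈ Set.Icc _ _ from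
          ⟨by simpa using ih.le, hpos⟩)
      exact hno i c hcv t ht ht0
  have := hneg Finset.univ
  simp only [Finset.piecewise_univ] at this
  linarith

/-- The closed cube of the grid of mesh `1 / m` with integer index `q`. -/
def gridCube {n : ℕ} (m : ℕ) (q : Fin n → ℤ) : Set (Fin n → ℝ) :=
  Set.Icc (fun i => (q i : ℝ) / m) (fun i => ((q i : ℝ) + 1) / m)

lemma card_cubes_zero_on_edge_le {n k : ℕ} {U : Set (Fin n → ℝ)} (hU : Convex ℝ U)
    {g : (Fin n → ℝ) → ℝ} (hg : NonvanishingPartials U k g) {m : ℕ} (hm : 0 < m) (N : ℕ)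
    (j : Fin n) (σ : Fin n → ℤ) (hσ : ∀ i, σ i = 0 ∨ σ i = 1) (S : Finset (Fin n → ℤ))
    (hbox : ∀ q ∈ S, ∀ i, q i ∈ Finset.Icc (-(N : ℤ)) N) (hSU : ∀ q ∈ S, gridCube m q ⊆ U)
    (hS : ∀ q ∈ S, ∃ t ∈ Set.Icc ((q j : ℝ) / m) (((q j : ℝ) + 1) / m),
      g (Function.update (fun i => ((q i : ℝ) + σ i) / m) j t) = 0) :
    S.card ≤ 2 * k * (2 * N + 1) ^ (n - 1) := by
  have hm' : (0 : ℝ) < m := by exact_mod_cast hm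
  set T : Finset (Fin n → ℤ) :=
    Fintype.piFinset fun i => if i = j then {0} else Finset.Icc (-(N : ℤ)) N with hT
  have hTcard : T.card = (2 * N + 1) ^ (n - 1) := by
    have h1 (i : Fin n) : (if i = j then ({0} : Finset ℤ) else Finset.Icc (-(N : ℤ)) N).card =
        if i = j then 1 else 2 * N + 1 := by
      split_ifs
      · simp
      · rw [Int.card_Icc]; omega
    rw [hT, Fintype.card_piFinset]
    simp only [h1]
    rw [Finset.prod_ite]
    simp [Finset.filter_ne', Finset.card_erase_of_mem]
  rw [← hTcard]
  refine Finset.card_le_mul_card_image_of_maps_to (f := fun q => Function.update q j 0)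
    (fun q hq => ?_) _ fun p _ => ?_
  · rw [hT, Fintype.mem_piFinset]
    intro i
    by_cases hi : i = j
    · subst hi; simp
    · simpa [hi] using hbox q hq i
  · choose! τ hτ hτ0 using hS
    set A := S.filter fun q => Function.update q j 0 = p with hA
    have hAS (q) (hq : q ∈ A) : q ∈ S := (Finset.mem_filter.1 hq).1
    have hoff (q) (hq : q ∈ A) (i) (hi : i ≠ j) : q i = p i := by
      rw [← (Finset.mem_filter.1 hq).2]; simp [hi]
    set c : Fin n → ℝ := fun i => ((p i : ℝ) + σ i) / m with hc
    have hline (q) (hq : q ∈ A) (t : ℝ) :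
        Function.update (fun i => ((q i : ℝ) + σ i) / m) j t = Function.update c j t := by
      ext i
      by_cases hi : i = j
      · subst hi; simp
      · simp [hi, hc, hoff q hq i hi]
    have himg : (A.image τ).card ≤ k := by
      refine hg.card_zeros_on_line_le hU c j _ fun t ht => ?_
      obtain ⟨q, hq, rfl⟩ := Finset.mem_image.1 ht
      rw [← hline q hq]
      refine ⟨hSU q (hAS q hq) ?_, hτ0 q (hAS q hq)⟩
      rw [gridCube, ← Set.pi_univ_Icc]
      intro i _
      by_cases hi : i = j
      · subst hi; simpa using hτ q (hAS q hq)
      · simp only [Function.update_of_ne hi, Set.mem_Icc]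
        rcases hσ i with h | h <;> rw [h] <;> constructor <;> gcongr <;> simp
    refine (Finset.card_le_mul_card_image (f := τ) A 2 fun t _ => ?_).trans
      (Nat.mul_le_mul_left 2 himg)
    have hcard : (Finset.Icc (⌈m * t⌉ - 1) ⌊m * t⌋).card ≤ 2 := by
      rw [Int.card_Icc]
      have := Int.floor_le_ceil (m * t)
      omega
    refine (Finset.card_le_card_of_injOn (fun q => q j) (fun q hq => ?_) ?_).trans hcard
    · obtain ⟨hqA, rfl⟩ := Finset.mem_filter.1 hq
      have h := hτ q (hAS q hqA)
      rw [Set.mem_Icc, div_le_iff₀' hm', le_div_iff₀' hm'] at h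
      rw [Finset.mem_coe, Finset.mem_Icc]
      refine ⟨?_, Int.le_floor.2 h.1⟩
      rw [sub_le_iff_le_add, Int.ceil_le]
      exact_mod_cast h.2
    · intro q hq q' hq' h
      have hq := (Finset.mem_filter.1 hq).1
      have hq' := (Finset.mem_filter.1 hq').1
      ext i
      by_cases hi : i = j
      · subst hi; exact h
      · rw [hoff q hq i hi, hoff q' hq' i hi]

theorem exists_card_cubes_zero_le {n : ℕ} (hn : 1 ≤ n) (k : ℕ) :
    ∃ C : ℕ, ∀ U : Set (Fin n → ℝ), Convex ℝ U → ∀ g, NonvanishingPartials U k g →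
      ∀ m : ℕ, 0 < m → ∀ (N : ℕ) (S : Finset (Fin n → ℤ)),
        (∀ q ∈ S, ∀ i, q i ∈ Finset.Icc (-(N : ℤ)) N) → (∀ q ∈ S, gridCube m q ⊆ U) →
        (∀ q ∈ S, ∃ y ∈ gridCube m q, g y = 0) → S.card ≤ C * (2 * N + 1) ^ (n - 1) := by
  classical
  induction k with
  | zero =>
    refine ⟨0, fun U _ g hg m _ N S _ hSU hS => ?_⟩
    simp only [zero_mul, nonpos_iff_eq_zero, Finset.card_eq_zero]
    refine Finset.eq_empty_of_forall_notMem fun q hq => ?_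
    obtain ⟨y, hy, hy0⟩ := hS q hq
    exact hg.2 y (hSU q hq hy) hy0
  | succ k ih =>
    obtain ⟨C, hC⟩ := ih
    set V : Finset (Fin n → ℤ) := Fintype.piFinset fun _ => {0, 1} with hV
    refine ⟨n * C + n * (V.card * (2 * (k + 1))), fun U hU g hg m hm N S hbox hSU hS => ?_⟩
    have hg₀ := hg
    obtain ⟨hgc, g', hg', hk⟩ := hg
    have hm' : (0 : ℝ) < m := by exact_mod_cast hm
    set P : Fin n → Finset (Fin n → ℤ) := fun j =>
      S.filter fun q => ∃ y ∈ gridCube m q, g' j y = 0 with hP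
    set Q : Fin n → (Fin n → ℤ) → Finset (Fin n → ℤ) := fun j σ =>
      S.filter fun q => ∃ t ∈ Set.Icc ((q j : ℝ) / m) (((q j : ℝ) + 1) / m),
      g (Function.update (fun i => ((q i : ℝ) + σ i) / m) j t) = 0 with hQ
    have hcover : S ⊆ (Finset.univ.biUnion P) ∪ Finset.univ.biUnion fun j => V.biUnion (Q j) := by
      intro q hq
      rw [Finset.mem_union]
      by_cases hcrit : ∃ j, ∃ y ∈ gridCube m q, g' j y = 0
      · left
        obtain ⟨j, hj⟩ := hcrit
        exact Finset.mem_biUnion.2 ⟨j, Finset.mem_univ _, Finset.mem_filter.2 ⟨hq, hj⟩⟩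
      · right
        push Not at hcrit
        obtain ⟨z, hz, hz0⟩ := hS q hq
        obtain ⟨j, c, hc, t, ht, ht0⟩ := exists_zero_on_edge
          (a := fun i => (q i : ℝ) / m) (b := fun i => ((q i : ℝ) + 1) / m)
          (fun i => by gcongr; simp) hn (hgc.mono (hSU q hq))
          (fun j y hy => hg' j y (hSU q hq hy)) hcrit hz hz0
        have hσ (i : Fin n) : ∃ s : ℤ, (s = 0 ∨ s = 1) ∧ c i = ((q i : ℝ) + s) / m := by
          rcases hc i with h | h
          · exact ⟨0, Or.inl rfl, by simpa using h⟩
          · exact ⟨1, Or.inr rfl, by simpa using h⟩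
        choose σ hσ hcσ using hσ
        obtain rfl : c = fun i => ((q i : ℝ) + σ i) / m := funext hcσ
        refine Finset.mem_biUnion.2 ⟨j, Finset.mem_univ _, Finset.mem_biUnion.2 ⟨σ, ?_, ?_⟩⟩
        · simpa [hV, Fintype.mem_piFinset] using hσ
        · exact Finset.mem_filter.2 ⟨hq, t, ht, ht0⟩
    have hPcard (j : Fin n) : (P j).card ≤ C * (2 * N + 1) ^ (n - 1) :=
      hC U hU (g' j) (hk j) m hm N (P j) (fun q hq => hbox q (Finset.mem_filter.1 hq).1)
        (fun q hq => hSU q (Finset.mem_filter.1 hq).1) fun q hq => (Finset.mem_filter.1 hq).2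
    have hQcard (j : Fin n) (σ) (hσ : σ ∈ V) :
        (Q j σ).card ≤ 2 * (k + 1) * (2 * N + 1) ^ (n - 1) :=
      card_cubes_zero_on_edge_le hU hg₀ hm N j σ (by simpa [hV, Fintype.mem_piFinset] using hσ) _
        (fun q hq => hbox q (Finset.mem_filter.1 hq).1)
        (fun q hq => hSU q (Finset.mem_filter.1 hq).1) fun q hq => (Finset.mem_filter.1 hq).2
    calc S.card ≤ _ := Finset.card_le_card hcover
      _ ≤ _ := Finset.card_union_le _ _
      _ ≤ n * (C * (2 * N + 1) ^ (n - 1)) +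
          n * (V.card * (2 * (k + 1) * (2 * N + 1) ^ (n - 1))) := by
        gcongr
        · simpa using Finset.card_biUnion_le_card_mul Finset.univ P _ fun j _ => hPcard j
        · simpa using Finset.card_biUnion_le_card_mul Finset.univ (fun j => V.biUnion (Q j)) _
            fun j _ => Finset.card_biUnion_le_card_mul V (Q j) _ (hQcard j)
      _ = _ := by ring

lemma mem_gridCube_floor {n m : ℕ} (hm : 0 < m) (y : Fin n → ℝ) :
    y ∈ gridCube m fun i => ⌊m * y i⌋ := by
  have hm' : (0 : ℝ) < m := by exact_mod_cast hm
  refine ⟨fun i => ?_, fun i => ?_⟩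
  · exact (div_le_iff₀' hm').2 (Int.floor_le _)
  · exact (le_div_iff₀' hm').2 (Int.lt_floor_add_one _).le

lemma ediam_gridCube_le {n m : ℕ} (q : Fin n → ℤ) :
    ediam (gridCube m q) ≤ ENNReal.ofReal (1 / m) := by
  rw [gridCube, ← Set.pi_univ_Icc]
  refine ediam_pi_le_of_le fun i => ?_
  rw [Real.ediam_Icc]
  exact ENNReal.ofReal_le_ofReal (by rw [← sub_div]; simp)

/-- A zero set of a function with nonvanishing partial derivatives of order `k` has bounded
codimension one Hausdorff measure. -/
theorem exists_hausdorffMeasure_zeros_le {n : ℕ} (hn : 1 ≤ n) (k R : ℕ) :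
    ∃ C : ℝ≥0∞, C < ⊤ ∧ ∀ U : Set (Fin n → ℝ), Convex ℝ U → IsOpen U →
      U ⊆ closedBall 0 R → ∀ g, NonvanishingPartials U k g →
        μH[(n : ℝ) - 1] {y | y ∈ U ∧ g y = 0} ≤ C := by
  classical
  obtain ⟨C, hC⟩ := exists_card_cubes_zero_le hn k
  refine ⟨(C * (2 * R + 1) ^ (n - 1) : ℕ), ENNReal.natCast_lt_top _, fun U hU hUo hUR g hg => ?_⟩
  have hdim : (n : ℝ) - 1 = ((n - 1 : ℕ) : ℝ) := by push_cast [hn]; rfl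
  set S : ℕ → Finset (Fin n → ℤ) := fun m =>
    (Fintype.piFinset fun _ => Finset.Icc (-((R * (m + 1) : ℕ) : ℤ)) (R * (m + 1) : ℕ)).filter
      fun q => gridCube (m + 1) q ⊆ U ∧ ∃ y ∈ gridCube (m + 1) q, g y = 0 with hS
  have hScard (m : ℕ) : (S m).card ≤ C * (2 * R + 1) ^ (n - 1) * (m + 1) ^ (n - 1) := by
    have h := hC U hU g hg (m + 1) m.succ_pos (R * (m + 1)) (S m)
      (fun q hq => Fintype.mem_piFinset.1 (Finset.mem_filter.1 hq).1)
      (fun q hq => (Finset.mem_filter.1 hq).2.1) (fun q hq => (Finset.mem_filter.1 hq).2.2)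
    refine h.trans ?_
    rw [mul_assoc, ← mul_pow]
    gcongr
    nlinarith
  set Z : ℕ → Set (Fin n → ℝ) := fun M =>
    {y | g y = 0 ∧ closedBall y (1 / ((M : ℝ) + 1)) ⊆ U} with hZ
  have hZmono : Monotone Z := fun M M' h y hy =>
    ⟨hy.1, (closedBall_subset_closedBall (Nat.one_div_le_one_div h)).trans hy.2⟩
  have hcover (M m : ℕ) (hMm : M ≤ m) : Z M ⊆ ⋃ q : S m, gridCube (m + 1) (q : Fin n → ℤ) := by
    intro y hy
    have hyU : y ∈ U := hy.2 (mem_closedBall_self (by positivity))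
    have hcube := mem_gridCube_floor m.succ_pos y
    refine Set.mem_iUnion.2 ⟨⟨fun i => ⌊(m + 1 : ℕ) * y i⌋, ?_⟩, hcube⟩
    refine Finset.mem_filter.2 ⟨Fintype.mem_piFinset.2 fun i => ?_, fun x hx => ?_, y, hcube, hy.1⟩
    · have hyi : |y i| ≤ R :=
        (norm_le_pi_norm y i).trans (by simpa using hUR hyU)
      have h := abs_le.1 hyi
      rw [Finset.mem_Icc, Int.le_floor]
      have hfl : ((⌊(m + 1 : ℕ) * y i⌋ : ℤ) : ℝ) ≤ ((R * (m + 1) : ℕ) : ℤ) := by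
        refine (Int.floor_le _).trans ?_
        push_cast
        nlinarith
      refine ⟨?_, by exact_mod_cast hfl⟩
      push_cast
      nlinarith
    · refine (hZmono hMm hy).2 ?_
      rw [mem_closedBall, dist_comm, ← ENNReal.ofReal_le_ofReal_iff (by positivity), ← edist_dist]
      refine (edist_le_ediam_of_mem hcube hx).trans ?_
      simpa using ediam_gridCube_le (m := m + 1) fun i => ⌊(m + 1 : ℕ) * y i⌋
  have hbound (M : ℕ) : μH[(n : ℝ) - 1] (Z M) ≤ (C * (2 * R + 1) ^ (n - 1) : ℕ) := by
    have hr : Filter.Tendsto (fun m : ℕ => ENNReal.ofReal (1 / ((m + 1 : ℕ) : ℝ))) Filter.atTop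
        (nhds 0) := by
      rw [← ENNReal.ofReal_zero]
      exact ENNReal.tendsto_ofReal (by simpa using tendsto_one_div_add_atTop_nhds_zero_nat (𝕜 := ℝ))
    refine (Measure.hausdorffMeasure_le_liminf_sum (ι := fun m => S m) _ (Z M) _ hr
      (fun m q => gridCube (m + 1) (q : Fin n → ℤ))
      (Filter.Eventually.of_forall fun m q => ediam_gridCube_le _)
      ((Filter.eventually_ge_atTop M).mono fun m hm => hcover M m hm)).trans ?_
    refine (Filter.liminf_le_liminf (v := fun _ => ((C * (2 * R + 1) ^ (n - 1) : ℕ) : ℝ≥0∞))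
      (Filter.Eventually.of_forall fun m => ?_)).trans_eq (Filter.liminf_const _)
    calc ∑ q : S m, ediam (gridCube (m + 1) (q : Fin n → ℤ)) ^ ((n : ℝ) - 1)
        ≤ ∑ q : S m, (((m + 1 : ℕ) : ℝ≥0∞)⁻¹) ^ (n - 1) := by
          refine Finset.sum_le_sum fun q _ => ?_
          rw [hdim, ENNReal.rpow_natCast]
          gcongr
          refine (ediam_gridCube_le _).trans_eq ?_
          rw [one_div, ENNReal.ofReal_inv_of_pos (by positivity), ENNReal.ofReal_natCast]
      _ = (S m).card * (((m + 1 : ℕ) : ℝ≥0∞)⁻¹) ^ (n - 1) := by simp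
      _ ≤ ((C * (2 * R + 1) ^ (n - 1) * (m + 1) ^ (n - 1) : ℕ) : ℝ≥0∞) *
          (((m + 1 : ℕ) : ℝ≥0∞)⁻¹) ^ (n - 1) := by gcongr; exact hScard m
      _ = ((C * (2 * R + 1) ^ (n - 1) : ℕ) : ℝ≥0∞) := by
          rw [Nat.cast_mul _ ((m + 1) ^ (n - 1)), mul_assoc, Nat.cast_pow (m + 1), ← mul_pow,
            ENNReal.mul_inv_cancel (by simp) (ENNReal.natCast_ne_top _), one_pow, mul_one]
  have hunion : {y | y ∈ U ∧ g y = 0} ⊆ ⋃ M, Z M := by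
    rintro y ⟨hyU, hy0⟩
    obtain ⟨ε, hε, hεU⟩ := Metric.isOpen_iff.1 hUo y hyU
    obtain ⟨M, hM⟩ := exists_nat_one_div_lt hε
    exact Set.mem_iUnion.2 ⟨M, hy0, (closedBall_subset_ball hM).trans hεU⟩
  refine (measure_mono hunion).trans ?_
  rw [hZmono.measure_iUnion]
  exact iSup_le hbound

lemma nonvanishingPartials_comp {n : ℕ} {E : Type*} [NormedAddCommGroup E] [NormedSpace ℝ E]
    (L : (Fin n → ℝ) →L[ℝ] E) {U : Set E} (hU : IsOpen U) {f : E → ℝ} {k : ℕ}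
    (hf : ContDiffOn ℝ k f U)
    (hne : ∀ y ∈ U, ∀ J : Fin k → Fin n,
      iteratedFDeriv ℝ k f y (fun i => L (Pi.single (J i) 1)) ≠ 0) :
    NonvanishingPartials (L ⁻¹' U) k (f ∘ L) := by
  have hcont (i : ℕ) (hi : i ≤ k) (v : Fin i → E) :
      ContinuousOn (fun y => iteratedFDeriv ℝ i f (L y) v) (L ⁻¹' U) := by
    have h : ContinuousOn (iteratedFDeriv ℝ i f) U :=
      (hf.continuousOn_iteratedFDerivWithin (by exact_mod_cast hi) hU.uniqueDiffOn).congr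
        fun x hx => (iteratedFDerivWithin_of_isOpen i hU hx).symm
    exact ((ContinuousMultilinearMap.apply ℝ (fun _ : Fin i => E) ℝ v).continuous.comp_continuousOn
      h).comp L.continuous.continuousOn fun _ h => h
  have key (p : ℕ) : ∀ i, p + i = k → ∀ J : Fin i → Fin n, NonvanishingPartials (L ⁻¹' U) p
      fun y => iteratedFDeriv ℝ i f (L y) (fun a => L (Pi.single (J a) 1)) := by
    induction p with
    | zero =>
      rintro i hi J
      obtain rfl : i = k := by omega
      exact ⟨hcont i le_rfl _, fun y hy => hne _ hy J⟩
    | succ p ih =>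
      intro i hi J
      refine ⟨hcont i (by omega) _, fun j y => iteratedFDeriv ℝ (i + 1) f (L y)
        (fun a => L (Pi.single ((Fin.cons j J : Fin (i + 1) → Fin n) a) 1)), fun j y hy => ?_,
        fun j => ih (i + 1) (by omega) _⟩
      have hd : DifferentiableAt ℝ (iteratedFDeriv ℝ i f) (L y) :=
        (hf.contDiffAt (hU.mem_nhds hy)).differentiableAt_iteratedFDeriv
          (by exact_mod_cast (by omega : i < k))
      have h1 : HasDerivAt (fun t => L (Function.update y j t)) (L (Pi.single j 1)) (y j) :=
        L.hasFDerivAt.comp_hasDerivAt _ (hasDerivAt_update y j (y j))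
      have h2 := (ContinuousMultilinearMap.apply ℝ (fun _ : Fin i => E) ℝ
        (fun a => L (Pi.single (J a) 1))).hasFDerivAt.comp (L y) hd.hasFDerivAt
      have h3 := HasFDerivAt.comp_hasDerivAt_of_eq (y j) h2 h1 (by simp)
      exact h3
  have h := key k 0 rfl Fin.elim0
  simpa [Function.comp_def] using h

theorem exists_hausdorffMeasure_zeros_le_of_iteratedFDeriv {n : ℕ} (hn : 1 ≤ n) {E : Type*}
    [NormedAddCommGroup E] [NormedSpace ℝ E] [MeasurableSpace E] [BorelSpace E]
    (L : (Fin n → ℝ) ≃L[ℝ] E) (k : ℕ) (r : ℝ) :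
    ∃ C : ℝ≥0∞, C < ⊤ ∧ ∀ U : Set E, Convex ℝ U → IsOpen U → U ⊆ closedBall 0 r →
      ∀ f : E → ℝ, ContDiffOn ℝ k f U →
        (∀ y ∈ U, ∀ J : Fin k → Fin n,
          iteratedFDeriv ℝ k f y (fun i => L (Pi.single (J i) 1)) ≠ 0) →
        μH[(n : ℝ) - 1] {y | y ∈ U ∧ f y = 0} ≤ C := by
  obtain ⟨R, hR⟩ := exists_nat_ge (‖(L.symm : E →L[ℝ] (Fin n → ℝ))‖ * r)
  obtain ⟨C, hC, h⟩ := exists_hausdorffMeasure_zeros_le hn k R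
  have hdim : (0 : ℝ) ≤ (n : ℝ) - 1 := by
    rw [sub_nonneg]; exact_mod_cast hn
  refine ⟨(‖(L : (Fin n → ℝ) →L[ℝ] E)‖₊ : ℝ≥0∞) ^ ((n : ℝ) - 1) * C,
    ENNReal.mul_lt_top (ENNReal.rpow_lt_top_of_nonneg hdim ENNReal.coe_ne_top) hC,
    fun U hU hUo hUr f hf hne => ?_⟩
  have h' := h (L ⁻¹' U) (hU.linear_preimage (L : (Fin n → ℝ) →ₗ[ℝ] E))
    (hUo.preimage L.continuous) (fun y hy => ?_) _
    (nonvanishingPartials_comp (L : (Fin n → ℝ) →L[ℝ] E) hUo hf hne)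
  · have himg : {y | y ∈ U ∧ f y = 0} ⊆
        (L : (Fin n → ℝ) →L[ℝ] E) '' {y | y ∈ L ⁻¹' U ∧ (f ∘ L) y = 0} := by
      rintro y ⟨hy, hy0⟩
      exact ⟨L.symm y, by simpa using ⟨hy, hy0⟩, by simp⟩
    refine (measure_mono himg).trans (((L : (Fin n → ℝ) →L[ℝ] E).lipschitz
      |>.hausdorffMeasure_image_le hdim _).trans ?_)
    gcongr
    exact h'
  · rw [mem_closedBall_zero_iff]
    have h1 := (L.symm : E →L[ℝ] (Fin n → ℝ)).le_opNorm (L y)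
    have h2 : ‖L y‖ ≤ r := by simpa using hUr hy
    simp only [ContinuousLinearEquiv.coe_coe, ContinuousLinearEquiv.symm_apply_apply] at h1
    exact h1.trans ((mul_le_mul_of_nonneg_left h2 (norm_nonneg _)).trans hR)

lemma ContDiffAt.iteratedFDeriv_swap {E F : Type*} [NormedAddCommGroup E] [NormedSpace ℝ E]
    [NormedAddCommGroup F] [NormedSpace ℝ F] {f : E → F} (n : ℕ) :
    ∀ {x : E}, ContDiffAt ℝ (n + 1 : ℕ) f x → ∀ (i : Fin n) (v : Fin (n + 1) → E),
      iteratedFDeriv ℝ (n + 1) f x (v ∘ Equiv.swap i.castSucc i.succ) =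
        iteratedFDeriv ℝ (n + 1) f x v := by
  induction n with
  | zero => exact fun _ i => i.elim0
  | succ n ih =>
    intro x hf i v
    have hd : DifferentiableAt ℝ (iteratedFDeriv ℝ (n + 1) f) x :=
      hf.differentiableAt_iteratedFDeriv (by exact_mod_cast Nat.lt_succ_self _)
    rw [hd.iteratedFDeriv_succ_apply_left', hd.iteratedFDeriv_succ_apply_left']
    have hev : ∀ᶠ y in nhds x, ContDiffAt ℝ (n + 1 + 1 : ℕ) f y := hf.eventually (by simp)
    cases i using Fin.cases with
    | zero =>
      have hsucc : Fin.tail (Fin.tail (v ∘ Equiv.swap (Fin.castSucc 0) (Fin.succ 0))) =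
          Fin.tail (Fin.tail v) := by
        ext1 a
        simp only [Fin.tail, Function.comp_apply]
        rw [Equiv.swap_apply_of_ne_of_ne] <;> simp [Fin.ext_iff]
      set h : E → F := fun y => iteratedFDeriv ℝ n f y (Fin.tail (Fin.tail v)) with hh
      have hdiff (w : Fin (n + 1) → E) (hw : Fin.tail w = Fin.tail (Fin.tail v)) :
          (fun y => iteratedFDeriv ℝ (n + 1) f y w) =ᶠ[nhds x] fun y => fderiv ℝ h y (w 0) := by
        filter_upwards [hev] with y hy
        rw [(hy.differentiableAt_iteratedFDeriv
          (by exact_mod_cast (by omega))).iteratedFDeriv_succ_apply_left', hw]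
      have hC2 : ContDiffAt ℝ 2 h x := by
        have : ContDiffAt ℝ 2 (iteratedFDeriv ℝ n f) x :=
          hf.iteratedFDeriv_right (by norm_cast; omega)
        exact (ContinuousMultilinearMap.apply ℝ (fun _ : Fin n => E) F
          (Fin.tail (Fin.tail v))).contDiff.contDiffAt.comp x this
      have hsymm : IsSymmSndFDerivAt ℝ h x := hC2.isSymmSndFDerivAt (by simp)
      have hdh : DifferentiableAt ℝ (fderiv ℝ h) x :=
        (hC2.fderiv_right (m := 1) (by norm_num)).differentiableAt (by norm_num)
      have hsnd (u w : E) : fderiv ℝ (fun y => fderiv ℝ h y u) x w =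
          fderiv ℝ (fderiv ℝ h) x w u := by
        rw [fderiv_clm_apply hdh (by fun_prop)]
        simp
      rw [(hdiff _ hsucc).fderiv_eq, (hdiff _ rfl).fderiv_eq, hsnd, hsnd]
      simp only [Fin.tail, Function.comp_apply]
      simpa using hsymm _ _
    | succ i =>
      have h0 : (v ∘ Equiv.swap i.succ.castSucc i.succ.succ) 0 = v 0 := by
        simp only [Function.comp_apply]
        rw [Equiv.swap_apply_of_ne_of_ne] <;> simp [Fin.ext_iff]
      have htail : Fin.tail (v ∘ Equiv.swap i.succ.castSucc i.succ.succ) =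
          Fin.tail v ∘ Equiv.swap i.castSucc i.succ := by
        ext1 a
        simp only [Fin.tail, Function.comp_apply]
        rw [← Fin.succ_castSucc, (Fin.succ_injective _).swap_apply]
      rw [h0, htail]
      congr 1
      refine Filter.EventuallyEq.fderiv_eq ?_
      filter_upwards [hev] with y hy
      exact ih (hy.of_le (by exact_mod_cast Nat.le_succ _)) i (Fin.tail v)

/-- The `n`-th iterated derivative of a function that is `C^n` at a point is symmetric there. -/
theorem ContDiffAt.iteratedFDeriv_comp_perm_real {E F : Type*} [NormedAddCommGroup E]
    [NormedSpace ℝ E] [NormedAddCommGroup F] [NormedSpace ℝ F] {f : E → F} {n : ℕ} {x : E}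
    (hf : ContDiffAt ℝ n f x) (v : Fin n → E) (σ : Equiv.Perm (Fin n)) :
    iteratedFDeriv ℝ n f x (v ∘ σ) = iteratedFDeriv ℝ n f x v := by
  cases n with
  | zero => congr 1; ext i; exact i.elim0
  | succ n =>
    have hσ : σ ∈ Submonoid.closure
        (Set.range fun i : Fin n => Equiv.swap i.castSucc i.succ) := by
      rw [Equiv.Perm.mclosure_swap_castSucc_succ]; trivial
    induction hσ using Submonoid.closure_induction generalizing v with
    | mem τ hτ =>
      obtain ⟨i, rfl⟩ := hτ
      exact ContDiffAt.iteratedFDeriv_swap n hf i v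
    | one => rfl
    | mul τ ρ _ _ hτ hρ =>
      rw [Equiv.Perm.coe_mul, ← Function.comp_assoc, hρ, hτ]

lemma exists_diagonal_ne_zero {E : Type*} [NormedAddCommGroup E] [NormedSpace ℝ E] {l : ℕ}
    {T : ContinuousMultilinearMap ℝ (fun _ : Fin l => E) ℝ}
    (hsymm : ∀ (v : Fin l → E) (σ : Equiv.Perm (Fin l)), T (v ∘ σ) = T v) (hT : T ≠ 0) :
    ∃ w : E, T (fun _ => w) ≠ 0 := by
  by_contra! h
  refine hT (ContinuousMultilinearMap.ext fun v => ?_)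
  have h1 := ContinuousMultilinearMap.iteratedFDeriv_comp_diagonal T 0 v
  have h2 (σ : Equiv.Perm (Fin l)) : T (fun i => v (σ i)) = T v := hsymm v σ
  have h3 : (fun x => T fun _ => x) = fun _ => 0 := funext h
  rw [h3] at h1
  simp only [h2, Finset.sum_const, Finset.card_univ, nsmul_eq_mul] at h1
  rw [iteratedFDeriv_fun_zero] at h1
  simpa [Fintype.card_perm, Nat.factorial_ne_zero] using h1.symm

lemma exists_basis_ne_zero {n : ℕ} {E : Type*} [NormedAddCommGroup E] [NormedSpace ℝ E]
    (L₀ : (Fin n → ℝ) ≃L[ℝ] E) {l : ℕ} {T : ContinuousMultilinearMap ℝ (fun _ : Fin l => E) ℝ}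
    (hsymm : ∀ (v : Fin l → E) (σ : Equiv.Perm (Fin l)), T (v ∘ σ) = T v) (hT : T ≠ 0) :
    ∃ L : (Fin n → ℝ) ≃L[ℝ] E, ∀ J : Fin l → Fin n,
      T (fun i => L (Pi.single (J i) 1)) ≠ 0 := by
  obtain ⟨w, hw⟩ := exists_diagonal_ne_zero hsymm hT
  set ω := L₀.symm w with hω
  have hev (J : Fin l → Fin n) : ∀ᶠ δ : ℝ in nhdsWithin 0 (Set.Ioi 0),
      T (fun i => w + δ • L₀ (Pi.single (J i) 1)) ≠ 0 := by
    refine nhdsWithin_le_nhds (ContinuousAt.eventually_ne (Continuous.continuousAt ?_) ?_)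
    · exact T.cont.comp (by fun_prop)
    · simpa using hw
  have hne : ∀ᶠ δ : ℝ in nhdsWithin 0 (Set.Ioi 0), (∑ j, ω j) + δ ≠ 0 := by
    by_cases hs : ∑ j, ω j = 0
    · filter_upwards [self_mem_nhdsWithin] with δ hδ
      rw [hs, zero_add]
      exact ne_of_gt hδ
    · refine nhdsWithin_le_nhds (ContinuousAt.eventually_ne (by fun_prop) ?_)
      simpa using hs
  obtain ⟨δ, hδ, hsum, hδ0⟩ :=
    ((Filter.eventually_all.2 hev).and (hne.and self_mem_nhdsWithin)).exists
  set M : (Fin n → ℝ) →ₗ[ℝ] (Fin n → ℝ) :=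
    (∑ j, LinearMap.proj j : (Fin n → ℝ) →ₗ[ℝ] ℝ).smulRight ω + δ • LinearMap.id with hM
  have hMapp (a : Fin n → ℝ) : M a = (∑ j, a j) • ω + δ • a := by
    simp [hM, LinearMap.sum_apply]
  have hinj : Function.Injective M := by
    rw [← LinearMap.ker_eq_bot, LinearMap.ker_eq_bot']
    intro a ha
    rw [hMapp] at ha
    have hcoord (i : Fin n) : (∑ j, a j) * ω i + δ * a i = 0 := by
      simpa using congrFun ha i
    have hA : (∑ j, a j) * ((∑ j, ω j) + δ) = 0 := by
      rw [mul_add, Finset.mul_sum, mul_comm _ δ, Finset.mul_sum, ← Finset.sum_add_distrib]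
      exact Finset.sum_eq_zero fun i _ => hcoord i
    ext i
    have := hcoord i
    rw [(mul_eq_zero.1 hA).resolve_right hsum, zero_mul, zero_add] at this
    exact (mul_eq_zero.1 this).resolve_left (ne_of_gt hδ0)
  refine ⟨(LinearEquiv.ofInjectiveEndo M hinj).toContinuousLinearEquiv.trans L₀, fun J => ?_⟩
  convert hδ J using 3 with i
  simp [hMapp, hω]

/-- Finitely many bases suffice to make all mixed values of symmetric multilinear forms nonzero,
uniformly under relatively small perturbations. -/
theorem exists_finset_bases {n : ℕ} {E : Type*} [NormedAddCommGroup E] [NormedSpace ℝ E]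
    (L₀ : (Fin n → ℝ) ≃L[ℝ] E) (l : ℕ) :
    ∃ (F : Finset ((Fin n → ℝ) ≃L[ℝ] E)) (δ : ℝ), 0 < δ ∧
      ∀ T : ContinuousMultilinearMap ℝ (fun _ : Fin l => E) ℝ,
        (∀ (v : Fin l → E) (σ : Equiv.Perm (Fin l)), T (v ∘ σ) = T v) → T ≠ 0 →
        ∃ L ∈ F, ∀ T' : ContinuousMultilinearMap ℝ (fun _ : Fin l => E) ℝ,
          ‖T' - T‖ < δ * ‖T‖ → ∀ J : Fin l → Fin n, T' (fun i => L (Pi.single (J i) 1)) ≠ 0 := by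
  have hfin : FiniteDimensional ℝ E := LinearEquiv.finiteDimensional L₀.toLinearEquiv
  have hfin' : FiniteDimensional ℝ (ContinuousMultilinearMap ℝ (fun _ : Fin l => E) ℝ) :=
    FiniteDimensional.of_injective
      (ContinuousMultilinearMap.toMultilinearMapLinear :
        ContinuousMultilinearMap ℝ (fun _ : Fin l => E) ℝ →ₗ[ℝ] _)
      ContinuousMultilinearMap.toMultilinearMap_injective
  have hproper : ProperSpace (ContinuousMultilinearMap ℝ (fun _ : Fin l => E) ℝ) :=
    FiniteDimensional.proper_real _
  have happ (v : Fin l → E) :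
      Continuous fun T : ContinuousMultilinearMap ℝ (fun _ : Fin l => E) ℝ => T v :=
    (ContinuousMultilinearMap.apply ℝ (fun _ : Fin l => E) ℝ v).continuous
  set K : Set (ContinuousMultilinearMap ℝ (fun _ : Fin l => E) ℝ) :=
    sphere 0 1 ∩ {T | ∀ (v : Fin l → E) (σ : Equiv.Perm (Fin l)), T (v ∘ σ) = T v} with hK
  have hKc : IsCompact K := by
    refine (isCompact_sphere 0 1).inter_right ?_
    simp only [Set.ofPred_forall]
    exact isClosed_iInter fun v => isClosed_iInter fun σ => isClosed_eq (happ _) (happ _)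
  set O : ((Fin n → ℝ) ≃L[ℝ] E) → Set (ContinuousMultilinearMap ℝ (fun _ : Fin l => E) ℝ) :=
    fun L => {T | ∀ J : Fin l → Fin n, T (fun i => L (Pi.single (J i) 1)) ≠ 0} with hO
  have hOo (L) : IsOpen (O L) := by
    simp only [hO, Set.ofPred_forall]
    exact isOpen_iInter_of_finite fun J => isOpen_ne_fun (happ _) continuous_const
  obtain ⟨F, hF⟩ := hKc.elim_finite_subcover O hOo fun T hT => by
    obtain ⟨L, hL⟩ := exists_basis_ne_zero L₀ hT.2 (ne_of_mem_sphere hT.1 one_ne_zero)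
    exact Set.mem_iUnion.2 ⟨L, hL⟩
  obtain ⟨δ, hδ, hδF⟩ := lebesgue_number_lemma_of_metric hKc
    (c := fun L : F => O L) (fun L => hOo L) (fun T hT => by
      obtain ⟨L, hL, hTL⟩ := Set.mem_iUnion₂.1 (hF hT)
      exact Set.mem_iUnion.2 ⟨⟨L, hL⟩, hTL⟩)
  refine ⟨F, δ, hδ, fun T hsymm hT => ?_⟩
  have hTn : 0 < ‖T‖ := norm_pos_iff.2 hT
  obtain ⟨L, hL⟩ := hδF (‖T‖⁻¹ • T) ⟨by simp [norm_smul, hTn.ne'], fun v σ => by simp [hsymm]⟩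
  refine ⟨L, L.2, fun T' hT' J hJ => ?_⟩
  have hmem : ‖T‖⁻¹ • T' ∈ ball (‖T‖⁻¹ • T) δ := by
    have hsub : ‖T‖⁻¹ • T' - ‖T‖⁻¹ • T = ‖T‖⁻¹ • (T' - T) := by
      ext
      simp [mul_sub]
    rw [mem_ball, dist_eq_norm, hsub, norm_smul, norm_inv, norm_norm, inv_mul_lt_iff₀ hTn,
      mul_comm]
    exact hT'
  exact hL hmem J (by simp [hJ])

lemma norm_le_sum_abs_apply_single {n l : ℕ}
    (T : ContinuousMultilinearMap ℝ (fun _ : Fin l => EuclideanSpace ℝ (Fin n)) ℝ) :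
    ‖T‖ ≤ ∑ m : Fin l → Fin n, |T fun i => EuclideanSpace.single (m i) 1| := by
  refine ContinuousMultilinearMap.opNorm_le_bound
    (Finset.sum_nonneg fun _ _ => abs_nonneg _) fun v => ?_
  have hv : T v = ∑ m : Fin l → Fin n,
      (∏ i, v i (m i)) • T fun i => EuclideanSpace.single (m i) 1 := by
    simp_rw [← T.map_smul_univ]
    rw [← T.map_sum (fun i (j : Fin n) => v i j • EuclideanSpace.single j (1 : ℝ))]
    congr 1
    ext i : 1
    have := (EuclideanSpace.basisFun (Fin n) ℝ).sum_repr (v i)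
    simpa using this.symm
  rw [hv, Finset.sum_mul]
  refine (norm_sum_le _ _).trans (Finset.sum_le_sum fun m _ => ?_)
  rw [norm_smul, norm_prod, mul_comm, Real.norm_eq_abs (T _)]
  gcongr with i
  exact PiLp.norm_apply_le (v i) (m i)

lemma uniqueDiffOn_closedBall {E : Type*} [NormedAddCommGroup E] [NormedSpace ℝ E] :
    UniqueDiffOn ℝ (closedBall (0 : E) 1) :=
  uniqueDiffOn_convex (convex_closedBall 0 1)
    ⟨0, ball_subset_interior_closedBall (mem_ball_self one_pos)⟩

lemma norm_iteratedFDerivWithin_le_Mder {n l : ℕ} {f : EuclideanSpace ℝ (Fin n) → ℝ}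
    (hf : ContDiffOn ℝ l f (closedBall 0 1)) {z : EuclideanSpace ℝ (Fin n)}
    (hz : z ∈ closedBall 0 1) :
    ‖iteratedFDerivWithin ℝ l f (closedBall 0 1) z‖ ≤ Mder n l f := by
  refine (norm_le_sum_abs_apply_single _).trans ?_
  set g : EuclideanSpace ℝ (Fin n) → ℝ := fun z => ∑ m : Fin l → Fin n,
    |iteratedFDerivWithin ℝ l f (closedBall 0 1) z fun i => EuclideanSpace.single (m i) 1| with hg
  have hgc : ContinuousOn g (closedBall 0 1) := by
    refine continuousOn_finsetSum _ fun m _ => ContinuousOn.abs ?_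
    exact (ContinuousMultilinearMap.apply ℝ (fun _ : Fin l => EuclideanSpace ℝ (Fin n)) ℝ
      _).continuous.comp_continuousOn
        (hf.continuousOn_iteratedFDerivWithin le_rfl uniqueDiffOn_closedBall)
  obtain ⟨B, hB⟩ := (isCompact_closedBall (0 : EuclideanSpace ℝ (Fin n)) 1).bddAbove_image hgc
  have hg0 (z) : 0 ≤ g z := Finset.sum_nonneg fun _ _ => abs_nonneg _
  have hB' (z) (hz : z ∈ closedBall 0 1) : g z ≤ B := hB ⟨z, hz, rfl⟩
  have hbdd : BddAbove (Set.range fun z => ⨆ _ : z ∈ closedBall (0 : EuclideanSpace ℝ (Fin n)) 1,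
      g z) := by
    refine ⟨B, ?_⟩
    rintro _ ⟨y, rfl⟩
    exact Real.iSup_le (fun hy => hB' y hy) ((hg0 z).trans (hB' z hz))
  calc g z = ⨆ _ : z ∈ closedBall (0 : EuclideanSpace ℝ (Fin n)) 1, g z := by
        have : Nonempty (z ∈ closedBall (0 : EuclideanSpace ℝ (Fin n)) 1) := ⟨hz⟩
        exact ciSup_const.symm
    _ ≤ Mder n l f := le_ciSup hbdd z

lemma Mder_zero_le {n : ℕ} {f : EuclideanSpace ℝ (Fin n) → ℝ} {c : ℝ} (hc : 0 ≤ c)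
    (hf : ∀ z ∈ closedBall (0 : EuclideanSpace ℝ (Fin n)) 1, |f z| ≤ c) : Mder n 0 f ≤ c := by
  refine Real.iSup_le (fun z => Real.iSup_le (fun hz => ?_) hc) hc
  simpa using hf z hz

/-- Bounds on all derivatives at one point of the unit ball and on the top one everywhere bound
the intermediate derivatives on the whole ball. -/
lemma norm_iteratedFDerivWithin_le_of_le_at {E : Type*} [NormedAddCommGroup E] [NormedSpace ℝ E]
    {f : E → ℝ} {d : ℕ} (hf : ContDiffOn ℝ d f (closedBall 0 1)) {a ε : ℝ} (x : E)
    (hx : x ∈ closedBall 0 1)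
    (hε : ∀ y ∈ closedBall (0 : E) 1, ‖iteratedFDerivWithin ℝ d f (closedBall 0 1) y‖ ≤ ε)
    (ha : ∀ l < d, ‖iteratedFDerivWithin ℝ l f (closedBall 0 1) x‖ ≤ a) (i l : ℕ)
    (hil : l + i = d) (y : E) (hy : y ∈ closedBall 0 1) :
    ‖iteratedFDerivWithin ℝ l f (closedBall 0 1) y‖ ≤ 2 ^ i * (a + ε) - a := by
  induction i generalizing l y with
  | zero =>
    obtain rfl : l = d := by omega
    simpa using hε y hy
  | succ i ih =>
    have hld : l < d := by omega
    have h1 := (convex_closedBall (0 : E) 1).norm_image_sub_le_of_norm_fderivWithin_le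
      (hf.differentiableOn_iteratedFDerivWithin (by exact_mod_cast hld) uniqueDiffOn_closedBall)
      (fun z hz => norm_fderivWithin_iteratedFDerivWithin.trans_le
        (ih (l + 1) (by omega) z hz)) hx hy
    have h2 : ‖y - x‖ ≤ 2 := by
      have := norm_sub_le y x
      rw [mem_closedBall_zero_iff] at hx hy
      linarith
    have h0 : 0 ≤ 2 ^ i * (a + ε) - a := (norm_nonneg _).trans (ih (l + 1) (by omega) y hy)
    have h3 := norm_sub_norm_le (iteratedFDerivWithin ℝ l f (closedBall 0 1) y)
      (iteratedFDerivWithin ℝ l f (closedBall 0 1) x)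
    have h4 := mul_le_mul_of_nonneg_left h2 h0
    have h5 := ha l hld
    rw [pow_succ]
    linarith

lemma hausdorffMeasure_sphere_lt_top {n : ℕ} (hn : 1 ≤ n) :
    μH[(n : ℝ) - 1] (sphere (0 : EuclideanSpace ℝ (Fin n)) 1) < ⊤ := by
  set f : EuclideanSpace ℝ (Fin n) → ℝ := fun x => ‖x‖ ^ 2 - 1 with hf
  have hfd : ContDiff ℝ 2 f := (contDiff_norm_sq ℝ).sub contDiff_const
  have hD (y : EuclideanSpace ℝ (Fin n)) (v : Fin 2 → EuclideanSpace ℝ (Fin n)) :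
      iteratedFDeriv ℝ 2 f y v = 2 * inner ℝ (v 0) (v 1) := by
    have h1 : fderiv ℝ f = fun x => (2 • innerSL ℝ : EuclideanSpace ℝ (Fin n) →L[ℝ] _) x := by
      ext1 x
      rw [hf, fderiv_sub_const, fderiv_norm_sq]
      rfl
    rw [iteratedFDeriv_two_apply, h1, ContinuousLinearMap.fderiv]
    simp only [smul_apply, nsmul_eq_mul]
    rfl
  have hT : iteratedFDeriv ℝ 2 f 0 ≠ 0 := by
    intro h
    have := hD 0 fun _ => EuclideanSpace.single ⟨0, hn⟩ 1
    rw [h] at this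
    simp at this
  obtain ⟨L, hL⟩ := exists_basis_ne_zero (EuclideanSpace.equiv (Fin n) ℝ).symm
    (fun v σ => hfd.contDiffAt.iteratedFDeriv_comp_perm_real v σ) hT
  obtain ⟨C, hC, hCf⟩ := exists_hausdorffMeasure_zeros_le_of_iteratedFDeriv hn L 2 2
  refine (measure_mono fun y hy => ?_).trans_lt ((hCf (ball 0 2) (convex_ball _ _) isOpen_ball
    ball_subset_closedBall f hfd.contDiffOn fun y _ J => ?_).trans_lt hC)
  · rw [mem_sphere_zero_iff_norm] at hy
    simp [hf, hy]
  · have hyJ := hL J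
    rwa [hD] at hyJ ⊢

lemma exists_dominant_derivative {n d : ℕ} (hd : 1 ≤ d) {f : EuclideanSpace ℝ (Fin n) → ℝ}
    (hf : ContDiffOn ℝ d f (closedBall 0 1)) (h0 : Mder n 0 f = 1)
    (hdf : Mder n d f ≤ 1 / 2 ^ (d + 1)) {x : EuclideanSpace ℝ (Fin n)}
    (hx : x ∈ closedBall 0 1) :
    ∃ l < d, iteratedFDerivWithin ℝ l f (closedBall 0 1) x ≠ 0 ∧
      ∀ y ∈ closedBall (0 : EuclideanSpace ℝ (Fin n)) 1,
        ‖iteratedFDerivWithin ℝ l f (closedBall 0 1) y -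
          iteratedFDerivWithin ℝ l f (closedBall 0 1) x‖ ≤
        2 ^ (d + 1) * ‖iteratedFDerivWithin ℝ l f (closedBall 0 1) x‖ * ‖y - x‖ := by
  obtain ⟨l, hl, hmax⟩ := (Finset.range d).exists_max_image
    (fun l => ‖iteratedFDerivWithin ℝ l f (closedBall 0 1) x‖) ⟨0, Finset.mem_range.2 hd⟩
  rw [Finset.mem_range] at hl
  set a := ‖iteratedFDerivWithin ℝ l f (closedBall 0 1) x‖ with ha
  have ha0 : 0 ≤ a := norm_nonneg _
  have hbound := norm_iteratedFDerivWithin_le_of_le_at hf x hx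
    (fun y hy => (norm_iteratedFDerivWithin_le_Mder hf hy).trans hdf)
    (fun k hk => hmax k (Finset.mem_range.2 hk))
  have hε : (2 : ℝ) ^ d * (a + 1 / 2 ^ (d + 1)) = 2 ^ d * a + 1 / 2 := by
    rw [pow_succ]
    field_simp
  have h1 : 1 ≤ 2 ^ d * a + 1 / 2 - a := by
    have hb (z) (hz : z ∈ closedBall (0 : EuclideanSpace ℝ (Fin n)) 1) :
        |f z| ≤ 2 ^ d * a + 1 / 2 - a := by
      have := hbound d 0 (zero_add d) z hz
      rwa [hε, norm_iteratedFDerivWithin_zero, Real.norm_eq_abs] at this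
    exact h0.symm.trans_le (Mder_zero_le ((abs_nonneg _).trans (hb x hx)) hb)
  have hapos : a ≠ 0 := fun h => by norm_num [h] at h1
  refine ⟨l, hl, norm_ne_zero_iff.1 hapos, fun y hy => ?_⟩
  refine Convex.norm_image_sub_le_of_norm_fderivWithin_le
    (hf.differentiableOn_iteratedFDerivWithin (by exact_mod_cast hl) uniqueDiffOn_closedBall)
    (fun z hz => norm_fderivWithin_iteratedFDerivWithin.trans_le
      ((hbound (d - (l + 1)) (l + 1) (by omega) z hz).trans ?_)) (convex_closedBall 0 1) hx hy
  have h2 : (2 : ℝ) ^ (d - (l + 1)) ≤ 2 ^ d := pow_le_pow_right₀ one_le_two (by omega)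
  have h3 : (2 : ℝ) ^ (d - (l + 1)) * (a + 1 / 2 ^ (d + 1)) ≤ 2 ^ d * (a + 1 / 2 ^ (d + 1)) := by
    gcongr
  rw [hε] at h3
  calc _ ≤ 2 ^ d * a + 1 / 2 - a := sub_le_sub_right h3 a
    _ ≤ 2 ^ (d + 1) * a := by
      rw [pow_succ]
      linarith

theorem stmt5 (n d : ℕ) (hn : 1 ≤ n) (hd : 1 ≤ d) :
    ∃ C : ℝ≥0∞, C < ⊤ ∧
      ∀ f : EuclideanSpace ℝ (Fin n) → ℝ,
        ContDiffOn ℝ d f (closedBall 0 1) →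
        Mder n 0 f = 1 → Mder n d f ≤ 1 / 2 ^ (d + 1) →
        μH[(n : ℝ) - 1]
            {x | x ∈ closedBall (0 : EuclideanSpace ℝ (Fin n)) 1 ∧ f x = 0} ≤ C := by
  choose F δ hδ hF using exists_finset_bases (EuclideanSpace.equiv (Fin n) ℝ).symm
  choose C hC hCf using fun (L : (Fin n → ℝ) ≃L[ℝ] EuclideanSpace ℝ (Fin n)) (l : ℕ) =>
    exists_hausdorffMeasure_zeros_le_of_iteratedFDeriv hn L l 1
  obtain ⟨η, hη, hη0⟩ : ∃ η : ℝ, (∀ l ∈ Finset.range d, 2 ^ (d + 1) * η < δ l) ∧ 0 < η := by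
    have hev : ∀ᶠ η : ℝ in nhdsWithin 0 (Set.Ioi 0),
        ∀ l ∈ Finset.range d, 2 ^ (d + 1) * η < δ l := by
      refine (Filter.eventually_all_finset _).2 fun l _ => nhdsWithin_le_nhds ?_
      refine ContinuousAt.eventually_lt (by fun_prop) continuousAt_const ?_
      simpa using hδ l
    exact (hev.and self_mem_nhdsWithin).exists
  obtain ⟨t, ht, htfin, hcover⟩ := exists_finite_cover_balls_of_isCompact_closure
    (isBounded_ball (x := (0 : EuclideanSpace ℝ (Fin n))) (r := 1)).isCompact_closure hη0
  lift t to Finset (EuclideanSpace ℝ (Fin n)) using htfin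
  refine ⟨μH[(n : ℝ) - 1] (sphere (0 : EuclideanSpace ℝ (Fin n)) 1) +
    ∑ _x ∈ t, ∑ l ∈ Finset.range d, ∑ L ∈ F l, C L l, ?_, fun f hf h0 hdf => ?_⟩
  · refine ENNReal.add_lt_top.2 ⟨hausdorffMeasure_sphere_lt_top hn, ?_⟩
    simp only [ENNReal.sum_lt_top]
    exact fun _ _ l _ L _ => hC L l
  have hsub : {x | x ∈ closedBall (0 : EuclideanSpace ℝ (Fin n)) 1 ∧ f x = 0} ⊆
      sphere 0 1 ∪
        ⋃ x ∈ t, {y | y ∈ ball (0 : EuclideanSpace ℝ (Fin n)) 1 ∩ ball x η ∧ f y = 0} := by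
    rintro y ⟨hy, hfy⟩
    rw [← ball_union_sphere] at hy
    refine hy.elim (fun hy => Or.inr ?_) Or.inl
    obtain ⟨x, hx, hyx⟩ := Set.mem_iUnion₂.1 (hcover hy)
    exact Set.mem_iUnion₂.2 ⟨x, hx, ⟨hy, hyx⟩, hfy⟩
  refine (measure_mono hsub).trans ((measure_union_le _ _).trans (add_le_add_right
    ((measure_biUnion_finset_le _ _).trans (Finset.sum_le_sum fun x hx => ?_)) _))
  have hx1 : x ∈ closedBall (0 : EuclideanSpace ℝ (Fin n)) 1 := ball_subset_closedBall (ht hx)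
  obtain ⟨l, hl, hne, hclose⟩ := exists_dominant_derivative hd hf h0 hdf hx1
  have hfat {y : EuclideanSpace ℝ (Fin n)} (hy : y ∈ ball 0 1) : ContDiffAt ℝ l f y :=
    (hf.contDiffAt (Filter.mem_of_superset (isOpen_ball.mem_nhds hy) ball_subset_closedBall)).of_le
      (by exact_mod_cast hl.le)
  have hwithin {y : EuclideanSpace ℝ (Fin n)} (hy : y ∈ ball 0 1) :
      iteratedFDerivWithin ℝ l f (closedBall 0 1) y = iteratedFDeriv ℝ l f y :=
    iteratedFDerivWithin_eq_iteratedFDeriv uniqueDiffOn_closedBall (hfat hy)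
      (ball_subset_closedBall hy)
  obtain ⟨L, hL, hLT⟩ := hF l (iteratedFDeriv ℝ l f x)
    (fun v σ => (hfat (ht hx)).iteratedFDeriv_comp_perm_real v σ) (hwithin (ht hx) ▸ hne)
  refine (hCf L l (ball 0 1 ∩ ball x η) ((convex_ball _ _).inter (convex_ball _ _))
    (isOpen_ball.inter isOpen_ball) (Set.inter_subset_left.trans ball_subset_closedBall) f
    (fun y hy => (hfat hy.1).contDiffWithinAt) fun y hy => hLT _ ?_).trans ?_
  · have hc := hclose y (ball_subset_closedBall hy.1)
    rw [hwithin hy.1, hwithin (ht hx)] at hc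
    have hpos : 0 < ‖iteratedFDeriv ℝ l f x‖ := norm_pos_iff.2 (hwithin (ht hx) ▸ hne)
    have hyx : ‖y - x‖ < η := by simpa [dist_eq_norm] using hy.2
    calc _ ≤ 2 ^ (d + 1) * ‖iteratedFDeriv ℝ l f x‖ * ‖y - x‖ := hc
      _ ≤ 2 ^ (d + 1) * ‖iteratedFDeriv ℝ l f x‖ * η := by gcongr
      _ = 2 ^ (d + 1) * η * ‖iteratedFDeriv ℝ l f x‖ := by ring
      _ < δ l * ‖iteratedFDeriv ℝ l f x‖ := by
        gcongr
        exact hη l (Finset.mem_range.2 hl)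
  · exact (Finset.single_le_sum (f := fun L => C L l) (fun _ _ => zero_le) hL).trans
      (Finset.single_le_sum (f := fun l => ∑ L ∈ F l, C L l) (fun _ _ => zero_le)
        (Finset.mem_range.2 hl))
end

section
/- For all positive integers n and d there exists a constant C(n,d) with the following property: for every finite set Z ⊆ B^n with minimal distance ρ between distinct points of Z, one has ((d+1)!/2) · hatR_d(Z) ≤ RG_d(Z) ≤ (C(n,d)/ρ^{d+1}) · hatR_d(Z). -/
open Metric

/-- The `d`-th rigidity constant of `Z ⊆ B^n`. -/
noncomputable def RG (n d : ℕ) (Z : Set (EuclideanSpace ℝ (Fin n))) : ℝ :=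
  sInf { r : ℝ | ∃ f : EuclideanSpace ℝ (Fin n) → ℝ,
    ContDiffOn ℝ (d + 1) f (closedBall 0 1) ∧ (∀ z ∈ Z, f z = 0) ∧
    Mder n 0 f = 1 ∧ r = Mder n (d + 1) f }

/-- The supremum of `|P|` over a subset `S` of `ℝⁿ`. -/
noncomputable def supPoly (n : ℕ) (S : Set (EuclideanSpace ℝ (Fin n)))
    (P : MvPolynomial (Fin n) ℝ) : ℝ :=
  ⨆ x ∈ S, |MvPolynomial.eval (fun i => x i) P|

/-- The reciprocal Remez constant `hatR_d(Z)`. -/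
noncomputable def hatR (n d : ℕ) (Z : Set (EuclideanSpace ℝ (Fin n))) : ℝ :=
  sInf { r : ℝ | ∃ P : MvPolynomial (Fin n) ℝ, P.totalDegree ≤ d ∧
    0 < supPoly n (closedBall 0 1) P ∧
    r = supPoly n Z P / supPoly n (closedBall 0 1) P }

section Sup

variable {α : Type*} {S : Set α} {g : α → ℝ}

lemma Real.biSup_le_of_forall_mem {c : ℝ} (hc : 0 ≤ c) (h : ∀ z ∈ S, g z ≤ c) :
    ⨆ z ∈ S, g z ≤ c :=
  Real.iSup_le (fun z => Real.iSup_le (fun hz => h z hz) hc) hc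

lemma Real.le_biSup_of_forall_le {c : ℝ} (hc : ∀ z ∈ S, g z ≤ c) {x : α} (hx : x ∈ S) :
    g x ≤ ⨆ z ∈ S, g z := by
  have hb : BddAbove (Set.range fun z => ⨆ _ : z ∈ S, g z) := by
    refine ⟨max c 0, ?_⟩
    rintro _ ⟨z, rfl⟩
    exact Real.iSup_le (fun hz => (hc z hz).trans (le_max_left _ _)) (le_max_right _ _)
  refine le_trans ?_ (le_ciSup hb x)
  simp [hx]

end Sup

section Basic

variable {n : ℕ}

lemma uniqueDiffOn_unitClosedBall :
    UniqueDiffOn ℝ (closedBall (0 : EuclideanSpace ℝ (Fin n)) 1) :=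
  uniqueDiffOn_convex (convex_closedBall 0 1)
    ⟨0, ball_subset_interior_closedBall (mem_ball_self one_pos)⟩

/-- The sum of the absolute values of the partial derivatives of order `l` at `z`. -/
noncomputable def sumPartials (n l : ℕ) (f : EuclideanSpace ℝ (Fin n) → ℝ)
    (z : EuclideanSpace ℝ (Fin n)) : ℝ :=
  ∑ m : Fin l → Fin n,
    |iteratedFDerivWithin ℝ l f (closedBall 0 1) z (fun i => EuclideanSpace.single (m i) 1)|

lemma sumPartials_nonneg (l : ℕ) (f : EuclideanSpace ℝ (Fin n) → ℝ) (z) :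
    0 ≤ sumPartials n l f z :=
  Finset.sum_nonneg fun _ _ => abs_nonneg _

lemma sumPartials_zero (f : EuclideanSpace ℝ (Fin n) → ℝ) (z) :
    sumPartials n 0 f z = |f z| := by
  simp [sumPartials]

lemma Mder_nonneg (l : ℕ) (f : EuclideanSpace ℝ (Fin n) → ℝ) : 0 ≤ Mder n l f :=
  Real.iSup_nonneg fun z => Real.iSup_nonneg fun _ => sumPartials_nonneg l f z

lemma Mder_le {l : ℕ} {f : EuclideanSpace ℝ (Fin n) → ℝ} {c : ℝ} (hc : 0 ≤ c)
    (h : ∀ z ∈ closedBall (0 : EuclideanSpace ℝ (Fin n)) 1, sumPartials n l f z ≤ c) :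
    Mder n l f ≤ c :=
  Real.biSup_le_of_forall_mem hc h

lemma sumPartials_le_Mder {l : ℕ} {f : EuclideanSpace ℝ (Fin n) → ℝ}
    (hf : ContDiffOn ℝ l f (closedBall 0 1)) {z : EuclideanSpace ℝ (Fin n)}
    (hz : z ∈ closedBall (0 : EuclideanSpace ℝ (Fin n)) 1) :
    sumPartials n l f z ≤ Mder n l f := by
  have hcont : ContinuousOn (sumPartials n l f) (closedBall 0 1) := by
    have h1 := hf.continuousOn_iteratedFDerivWithin (m := l) le_rfl uniqueDiffOn_unitClosedBall
    unfold sumPartials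
    refine continuousOn_finsetSum _ fun m _ => ContinuousOn.abs ?_
    intro x hx
    exact ((ContinuousMultilinearMap.apply ℝ _ ℝ _).continuous.continuousAt.comp_continuousWithinAt
      (h1 x hx))
  obtain ⟨c, hc⟩ := (isCompact_closedBall (0 : EuclideanSpace ℝ (Fin n)) 1).bddAbove_image hcont
  exact Real.le_biSup_of_forall_le (fun x hx => hc ⟨x, hx, rfl⟩) hz

lemma Mder_const_smul {l : ℕ} {f : EuclideanSpace ℝ (Fin n) → ℝ}
    (hf : ContDiffOn ℝ l f (closedBall 0 1)) {c : ℝ} (hc : 0 ≤ c) :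
    Mder n l (c • f) = c * Mder n l f := by
  unfold Mder
  rw [Real.mul_iSup_of_nonneg hc]
  congr 1
  ext z
  rw [Real.mul_iSup_of_nonneg hc]
  congr 1
  ext hz
  rw [Finset.mul_sum]
  refine Finset.sum_congr rfl fun m _ => ?_
  rw [iteratedFDerivWithin_const_smul_apply (hf z hz) uniqueDiffOn_unitClosedBall hz]
  simp [abs_mul, abs_of_nonneg hc]

end Basic

section Polynomial

variable {n : ℕ}

/-- A polynomial in `n` variables as a function on Euclidean space. -/
noncomputable def polyFun (P : MvPolynomial (Fin n) ℝ) (x : EuclideanSpace ℝ (Fin n)) : ℝ :=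
  MvPolynomial.eval (fun i => x i) P

lemma hasFDerivAt_polyFun (P : MvPolynomial (Fin n) ℝ) (x : EuclideanSpace ℝ (Fin n)) :
    HasFDerivAt (polyFun P)
      (∑ i, polyFun (MvPolynomial.pderiv i P) x • EuclideanSpace.proj (𝕜 := ℝ) i) x := by
  induction P using MvPolynomial.induction_on with
  | C a =>
    have : polyFun (MvPolynomial.C a : MvPolynomial (Fin n) ℝ) = fun _ => a := by
      ext y; simp [polyFun]
    simpa [this, polyFun] using hasFDerivAt_const a x
  | add p q hp hq =>
    convert! hp.add hq using 1
    · ext y; simp [polyFun]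
    · simp [polyFun, add_smul, Finset.sum_add_distrib]
  | mul_X p i hp =>
    have hX : HasFDerivAt (fun y : EuclideanSpace ℝ (Fin n) => y i)
        (EuclideanSpace.proj (𝕜 := ℝ) i) x :=
      (EuclideanSpace.proj (𝕜 := ℝ) i : EuclideanSpace ℝ (Fin n) →L[ℝ] ℝ).hasFDerivAt
    convert! hp.mul hX using 1
    · ext y; simp [polyFun]
    · ext v
      simp [polyFun, Finset.mul_sum, MvPolynomial.pderiv_X, Pi.single_apply, mul_add,
        Finset.sum_add_distrib, apply_ite, mul_comm, mul_left_comm]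

lemma contDiff_polyFun (P : MvPolynomial (Fin n) ℝ) {k : WithTop ℕ∞} :
    ContDiff ℝ k (polyFun P) := by
  induction P using MvPolynomial.induction_on with
  | C a =>
    convert! contDiff_const (c := a) using 1
    ext y; simp [polyFun]
  | add p q hp hq =>
    convert! hp.add hq using 1
    ext y; simp [polyFun]
  | mul_X p i hp =>
    have hX : ContDiff ℝ k (fun y : EuclideanSpace ℝ (Fin n) => y i) :=
      (EuclideanSpace.proj (𝕜 := ℝ) i : EuclideanSpace ℝ (Fin n) →L[ℝ] ℝ).contDiff
    convert! hp.mul hX using 1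
    ext y; simp [polyFun]

lemma MvPolynomial.totalDegree_pderiv_le {σ R : Type*} [CommSemiring R] {k : ℕ}
    {P : MvPolynomial σ R} (hP : P.totalDegree ≤ k + 1) (i : σ) :
    (MvPolynomial.pderiv i P).totalDegree ≤ k := by
  classical
  rw [P.as_sum, map_sum]
  refine MvPolynomial.totalDegree_finsetSum_le fun s hs => ?_
  rw [MvPolynomial.pderiv_monomial]
  rcases Nat.eq_zero_or_pos (s i) with h | h
  · simp [h]
  · refine (MvPolynomial.totalDegree_monomial_le _ _).trans ?_
    have h1 : s.degree ≤ k + 1 := (MvPolynomial.le_totalDegree hs).trans hP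
    have h2 : s - Finsupp.single i 1 + Finsupp.single i 1 = s :=
      tsub_add_cancel_of_le (by simpa using Nat.succ_le_of_lt h)
    have h3 := congrArg Finsupp.degree h2
    rw [map_add, Finsupp.degree_single] at h3
    change (s - Finsupp.single i 1).degree ≤ k
    omega

lemma iteratedFDeriv_polyFun_eq_zero {k : ℕ} {P : MvPolynomial (Fin n) ℝ}
    (hP : P.totalDegree ≤ k) (x : EuclideanSpace ℝ (Fin n)) :
    iteratedFDeriv ℝ (k + 1) (polyFun P) x = 0 := by
  induction k generalizing P x with
  | zero =>
    have hC := MvPolynomial.totalDegree_eq_zero_iff_eq_C.1 (Nat.le_zero.1 hP)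
    have : polyFun P = fun _ => MvPolynomial.coeff 0 P := by
      ext y; rw [polyFun, hC]; simp
    rw [this, iteratedFDeriv_const_of_ne (by norm_num)]
    rfl
  | succ k ih =>
    ext m
    rw [iteratedFDeriv_succ_apply_right]
    set v := m (Fin.last (k + 1))
    have hQ : (∑ i, MvPolynomial.C (v i) * MvPolynomial.pderiv i P).totalDegree ≤ k := by
      refine MvPolynomial.totalDegree_finsetSum_le fun i _ => ?_
      refine (MvPolynomial.totalDegree_mul _ _).trans ?_
      simpa using MvPolynomial.totalDegree_pderiv_le hP i
    have hfun : (ContinuousLinearMap.apply ℝ ℝ v) ∘ (fun y => fderiv ℝ (polyFun P) y) =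
        polyFun (∑ i, MvPolynomial.C (v i) * MvPolynomial.pderiv i P) := by
      ext y
      simp [(hasFDerivAt_polyFun P y).fderiv, polyFun, mul_comm]
    have hsm : ContDiff ℝ (k + 1 : ℕ) (fun y => fderiv ℝ (polyFun P) y) :=
      (contDiff_polyFun P (k := ((k + 1 + 1 : ℕ) : WithTop ℕ∞))).fderiv_right (by norm_cast)
    have := (ContinuousLinearMap.apply ℝ ℝ v).iteratedFDeriv_comp_left
      (hsm.contDiffAt (x := x)) (i := k + 1) le_rfl
    rw [hfun, ih hQ] at this
    have h2 := congrArg (fun T => T (Fin.init m)) this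
    simpa using h2.symm

end Polynomial

section Taylor

variable {n : ℕ}

lemma ContinuousMultilinearMap.apply_diagonal_eq_sum {l : ℕ}
    (T : ContinuousMultilinearMap ℝ (fun _ : Fin l => EuclideanSpace ℝ (Fin n)) ℝ)
    (x : EuclideanSpace ℝ (Fin n)) :
    T (fun _ => x) =
      ∑ m : Fin l → Fin n, (∏ i, x (m i)) * T (fun i => EuclideanSpace.single (m i) 1) := by
  have hx : x = ∑ j, x j • EuclideanSpace.single j (1 : ℝ) := by
    ext k
    simp [Finset.sum_apply, Pi.single_apply]
  conv_lhs => rw [hx]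
  rw [T.map_sum]
  refine Finset.sum_congr rfl fun m _ => ?_
  rw [T.map_smul_univ]
  rfl

lemma ContinuousMultilinearMap.abs_apply_diagonal_le {l : ℕ}
    (T : ContinuousMultilinearMap ℝ (fun _ : Fin l => EuclideanSpace ℝ (Fin n)) ℝ)
    {x : EuclideanSpace ℝ (Fin n)} (hx : ‖x‖ ≤ 1) :
    |T (fun _ => x)| ≤ ∑ m : Fin l → Fin n, |T (fun i => EuclideanSpace.single (m i) 1)| := by
  rw [T.apply_diagonal_eq_sum]
  refine (Finset.abs_sum_le_sum_abs _ _).trans (Finset.sum_le_sum fun m _ => ?_)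
  rw [abs_mul, Finset.abs_prod]
  refine mul_le_of_le_one_left (abs_nonneg _) (Finset.prod_le_one (fun _ _ => abs_nonneg _) ?_)
  intro i _
  exact (PiLp.norm_apply_le x (m i)).trans hx

/-- The homogeneous polynomial `x ↦ T (x, …, x)`. -/
noncomputable def diagonalPoly {l : ℕ}
    (T : ContinuousMultilinearMap ℝ (fun _ : Fin l => EuclideanSpace ℝ (Fin n)) ℝ) :
    MvPolynomial (Fin n) ℝ :=
  ∑ m : Fin l → Fin n,
    (∏ i, MvPolynomial.X (m i)) * MvPolynomial.C (T (fun i => EuclideanSpace.single (m i) 1))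

lemma polyFun_diagonalPoly {l : ℕ}
    (T : ContinuousMultilinearMap ℝ (fun _ : Fin l => EuclideanSpace ℝ (Fin n)) ℝ)
    (x : EuclideanSpace ℝ (Fin n)) : polyFun (diagonalPoly T) x = T (fun _ => x) := by
  rw [T.apply_diagonal_eq_sum]
  simp [polyFun, diagonalPoly]

lemma totalDegree_diagonalPoly_le {l : ℕ}
    (T : ContinuousMultilinearMap ℝ (fun _ : Fin l => EuclideanSpace ℝ (Fin n)) ℝ) :
    (diagonalPoly T).totalDegree ≤ l := by
  refine MvPolynomial.totalDegree_finsetSum_le fun m _ => ?_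
  refine (MvPolynomial.totalDegree_mul _ _).trans ?_
  rw [MvPolynomial.totalDegree_C, add_zero]
  refine (MvPolynomial.totalDegree_finsetProd _ _).trans ?_
  simp

lemma iteratedDerivWithin_segment {l : ℕ} {f : EuclideanSpace ℝ (Fin n) → ℝ}
    (hf : ContDiffOn ℝ l f (closedBall 0 1)) {x : EuclideanSpace ℝ (Fin n)}
    (hx : x ∈ closedBall (0 : EuclideanSpace ℝ (Fin n)) 1) {t : ℝ} (ht : t ∈ Set.Icc (0 : ℝ) 1)
    {k : ℕ} (hk : k ≤ l) :
    iteratedDerivWithin k (f ∘ ContinuousLinearMap.toSpanSingleton ℝ x) (Set.Icc 0 1) t =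
      iteratedFDerivWithin ℝ k f (closedBall 0 1) (t • x) (fun _ => x) := by
  set L := ContinuousLinearMap.toSpanSingleton ℝ x
  have hx1 : ‖x‖ ≤ 1 := by simpa using hx
  have hsub : Set.Icc (0 : ℝ) 1 ⊆ L ⁻¹' closedBall 0 1 := by
    intro s hs
    have : ‖s • x‖ ≤ 1 := by
      rw [norm_smul, Real.norm_of_nonneg hs.1]
      exact mul_le_one₀ hs.2 (norm_nonneg _) hx1
    simpa [L] using this
  have hu : UniqueDiffOn ℝ (L ⁻¹' closedBall 0 1) :=
    uniqueDiffOn_convex ((convex_closedBall _ _).linear_preimage L.toLinearMap)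
      (((convex_Icc (0 : ℝ) 1).nontrivial_iff_nonempty_interior.1
        ⟨0, by simp, 1, by simp, by simp⟩).mono (interior_mono hsub))
  have hkl : (k : WithTop ℕ∞) ≤ l := by exact_mod_cast hk
  rw [iteratedDerivWithin_eq_iteratedFDerivWithin,
    iteratedFDerivWithin_subset hsub uniqueDiffOn_Icc_zero_one hu
      (((hf.of_le hkl).comp_continuousLinearMap L)) ht,
    L.iteratedFDerivWithin_comp_right hf uniqueDiffOn_unitClosedBall hu (hsub ht) hkl]
  simp [L]

/-- **Taylor's theorem** on the unit ball, with the remainder measured by `Mder`. -/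
lemma exists_polynomial_abs_sub_le {d : ℕ} {f : EuclideanSpace ℝ (Fin n) → ℝ}
    (hf : ContDiffOn ℝ (d + 1 : ℕ) f (closedBall 0 1)) :
    ∃ P : MvPolynomial (Fin n) ℝ, P.totalDegree ≤ d ∧
      ∀ x ∈ closedBall (0 : EuclideanSpace ℝ (Fin n)) 1,
        |f x - polyFun P x| ≤ Mder n (d + 1) f / (d + 1).factorial := by
  let D : (k : ℕ) → ContinuousMultilinearMap ℝ
      (fun _ : Fin k => EuclideanSpace ℝ (Fin n)) ℝ :=
    fun k => iteratedFDerivWithin ℝ k f (closedBall 0 1) 0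
  refine ⟨∑ k ∈ Finset.range (d + 1),
    MvPolynomial.C ((k.factorial : ℝ)⁻¹) * diagonalPoly (D k), ?_, ?_⟩
  · refine MvPolynomial.totalDegree_finsetSum_le fun k hk => ?_
    refine (MvPolynomial.totalDegree_mul _ _).trans ?_
    rw [MvPolynomial.totalDegree_C, zero_add]
    exact (totalDegree_diagonalPoly_le _).trans (Nat.lt_succ_iff.1 (Finset.mem_range.1 hk))
  · intro x hx
    have hx1 : ‖x‖ ≤ 1 := by simpa using hx
    set L := ContinuousLinearMap.toSpanSingleton ℝ x with hL
    have hsub : Set.MapsTo L (Set.Icc (0 : ℝ) 1) (closedBall 0 1) := by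
      intro s hs
      have : ‖s • x‖ ≤ 1 := by
        rw [norm_smul, Real.norm_of_nonneg hs.1]
        exact mul_le_one₀ hs.2 (norm_nonneg _) hx1
      simpa [L] using this
    have hg : ContDiffOn ℝ (d + 1 : ℕ) (f ∘ L) (Set.Icc 0 1) :=
      hf.comp L.contDiff.contDiffOn hsub
    have hIcc : Set.uIcc (0 : ℝ) 1 = Set.Icc 0 1 := Set.uIcc_of_le zero_le_one
    have hIoo : Set.uIoo (0 : ℝ) 1 = Set.Ioo 0 1 := Set.uIoo_of_le zero_le_one
    have hT := taylor_mean_remainder_lagrange (f := f ∘ L) (x := 1) (x₀ := 0) (n := d)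
      zero_ne_one
    rw [hIcc, hIoo] at hT
    obtain ⟨t, ht, hrem⟩ := hT (hg.of_le (by norm_cast; omega))
      ((hg.differentiableOn_iteratedDerivWithin (by norm_cast; omega)
        uniqueDiffOn_Icc_zero_one).mono Set.Ioo_subset_Icc_self)
    have ht' : t ∈ Set.Icc (0 : ℝ) 1 := Set.Ioo_subset_Icc_self ht
    have hpoly : taylorWithinEval (f ∘ L) d (Set.Icc 0 1) 0 1 =
        polyFun (∑ k ∈ Finset.range (d + 1),
          MvPolynomial.C ((k.factorial : ℝ)⁻¹) * diagonalPoly (D k)) x := by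
      rw [taylor_within_apply]
      have : polyFun (∑ k ∈ Finset.range (d + 1),
          MvPolynomial.C ((k.factorial : ℝ)⁻¹) * diagonalPoly (D k)) x =
          ∑ k ∈ Finset.range (d + 1), (k.factorial : ℝ)⁻¹ * polyFun (diagonalPoly (D k)) x := by
        simp [polyFun]
      rw [this]
      refine Finset.sum_congr rfl fun k hk => ?_
      rw [iteratedDerivWithin_segment hf hx (by simp) (Finset.mem_range.1 hk).le,
        polyFun_diagonalPoly]
      simp [D]
    rw [hpoly, iteratedDerivWithin_segment hf hx ht' le_rfl] at hrem
    have hfx : (f ∘ L) 1 = f x := by simp [L]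
    rw [← hfx, hrem]
    rw [sub_zero, one_pow, mul_one, abs_div, Nat.abs_cast]
    gcongr
    refine (ContinuousMultilinearMap.abs_apply_diagonal_le _ hx1).trans ?_
    exact sumPartials_le_Mder hf (by simpa [L] using hsub ht')

end Taylor

section Remez

variable {n d : ℕ}

lemma supPoly_le {S : Set (EuclideanSpace ℝ (Fin n))} {P : MvPolynomial (Fin n) ℝ} {c : ℝ}
    (hc : 0 ≤ c) (h : ∀ x ∈ S, |polyFun P x| ≤ c) : supPoly n S P ≤ c :=
  Real.biSup_le_of_forall_mem hc h

lemma supPoly_nonneg (S : Set (EuclideanSpace ℝ (Fin n))) (P : MvPolynomial (Fin n) ℝ) :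
    0 ≤ supPoly n S P :=
  Real.iSup_nonneg fun _ => Real.iSup_nonneg fun _ => abs_nonneg _

lemma abs_polyFun_le_supPoly {S : Set (EuclideanSpace ℝ (Fin n))} (hS : IsCompact S)
    (P : MvPolynomial (Fin n) ℝ) {x : EuclideanSpace ℝ (Fin n)} (hx : x ∈ S) :
    |polyFun P x| ≤ supPoly n S P := by
  obtain ⟨c, hc⟩ := hS.bddAbove_image
    ((contDiff_polyFun P (k := 0)).continuous.abs.continuousOn (s := S))
  exact Real.le_biSup_of_forall_le (fun y hy => hc ⟨y, hy, rfl⟩) hx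

lemma supPoly_one_closedBall :
    supPoly n (closedBall 0 1) (1 : MvPolynomial (Fin n) ℝ) = 1 := by
  refine le_antisymm (supPoly_le zero_le_one fun x _ => by simp [polyFun]) ?_
  have := abs_polyFun_le_supPoly (isCompact_closedBall (0 : EuclideanSpace ℝ (Fin n)) 1) 1
    (mem_closedBall_self zero_le_one)
  simpa [polyFun] using this

lemma hatR_le {Z : Set (EuclideanSpace ℝ (Fin n))} {P : MvPolynomial (Fin n) ℝ}
    (hP : P.totalDegree ≤ d) (hpos : 0 < supPoly n (closedBall 0 1) P) :
    hatR n d Z ≤ supPoly n Z P / supPoly n (closedBall 0 1) P := by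
  refine csInf_le ⟨0, ?_⟩ ⟨P, hP, hpos, rfl⟩
  rintro _ ⟨Q, -, -, rfl⟩
  exact div_nonneg (supPoly_nonneg _ _) (supPoly_nonneg _ _)

lemma hatR_le_one (Z : Set (EuclideanSpace ℝ (Fin n))) : hatR n d Z ≤ 1 := by
  refine (hatR_le (P := 1) (by simp) (by simp [supPoly_one_closedBall])).trans ?_
  rw [supPoly_one_closedBall, div_one]
  exact supPoly_le zero_le_one fun x _ => by simp [polyFun]

lemma le_hatR {Z : Set (EuclideanSpace ℝ (Fin n))} {c : ℝ}
    (h : ∀ P : MvPolynomial (Fin n) ℝ, P.totalDegree ≤ d →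
      0 < supPoly n (closedBall 0 1) P → c ≤ supPoly n Z P / supPoly n (closedBall 0 1) P) :
    c ≤ hatR n d Z := by
  refine le_csInf ⟨_, 1, by simp, by simp [supPoly_one_closedBall], rfl⟩ ?_
  rintro _ ⟨P, hP, hpos, rfl⟩
  exact h P hP hpos

lemma factorial_div_two_mul_hatR_le {Z : Set (EuclideanSpace ℝ (Fin n))}
    (hZ : Z ⊆ closedBall 0 1) {f : EuclideanSpace ℝ (Fin n) → ℝ}
    (hf : ContDiffOn ℝ (d + 1 : ℕ) f (closedBall 0 1)) (hfZ : ∀ z ∈ Z, f z = 0)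
    (hf0 : Mder n 0 f = 1) :
    ((d + 1).factorial : ℝ) / 2 * hatR n d Z ≤ Mder n (d + 1) f := by
  obtain ⟨P, hPd, hP⟩ := exists_polynomial_abs_sub_le hf
  set t := Mder n (d + 1) f / (d + 1).factorial with ht
  have hfac : (0 : ℝ) < (d + 1).factorial := by positivity
  have ht0 : 0 ≤ t := div_nonneg (Mder_nonneg _ _) hfac.le
  suffices h : hatR n d Z ≤ 2 * t by
    calc ((d + 1).factorial : ℝ) / 2 * hatR n d Z
        ≤ ((d + 1).factorial : ℝ) / 2 * (2 * t) := by gcongr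
      _ = Mder n (d + 1) f := by rw [ht]; field_simp
  rcases le_or_gt t (1 / 2) with h | h
  · have hZP : supPoly n Z P ≤ t := by
      refine supPoly_le ht0 fun z hz => ?_
      simpa [hfZ z hz] using hP z (hZ hz)
    have hBP : 1 / 2 ≤ supPoly n (closedBall 0 1) P := by
      have : Mder n 0 f ≤ supPoly n (closedBall 0 1) P + t := by
        refine Mder_le (add_nonneg (supPoly_nonneg _ _) ht0) fun z hz => ?_
        rw [sumPartials_zero]
        have h1 := abs_polyFun_le_supPoly (isCompact_closedBall _ _) P hz
        have h2 := abs_add_le (polyFun P z) (f z - polyFun P z)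
        rw [add_sub_cancel] at h2
        linarith [hP z hz]
      linarith
    calc hatR n d Z ≤ supPoly n Z P / supPoly n (closedBall 0 1) P :=
          hatR_le hPd (by linarith)
      _ ≤ t / (1 / 2) := by gcongr
      _ = 2 * t := by ring
  · linarith [hatR_le_one (d := d) Z]

lemma RG_le {Z : Set (EuclideanSpace ℝ (Fin n))} {f : EuclideanSpace ℝ (Fin n) → ℝ}
    (hf : ContDiffOn ℝ (d + 1 : ℕ) f (closedBall 0 1)) (hfZ : ∀ z ∈ Z, f z = 0)
    (hpos : 0 < Mder n 0 f) : RG n d Z ≤ Mder n (d + 1) f / Mder n 0 f := by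
  refine csInf_le ⟨0, ?_⟩ ⟨(Mder n 0 f)⁻¹ • f, ?_, ?_, ?_, ?_⟩
  · rintro _ ⟨g, -, -, -, rfl⟩
    exact Mder_nonneg _ _
  · exact_mod_cast hf.const_smul _
  · intro z hz
    simp [hfZ z hz]
  · rw [Mder_const_smul (hf.of_le (by norm_cast; omega)) (inv_nonneg.2 hpos.le),
      inv_mul_cancel₀ hpos.ne']
  · rw [Mder_const_smul hf (inv_nonneg.2 hpos.le)]
    ring

lemma le_RG {Z : Set (EuclideanSpace ℝ (Fin n))} {c : ℝ}
    (hne : ∃ f : EuclideanSpace ℝ (Fin n) → ℝ, ContDiffOn ℝ (d + 1 : ℕ) f (closedBall 0 1) ∧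
      (∀ z ∈ Z, f z = 0) ∧ 0 < Mder n 0 f)
    (h : ∀ f : EuclideanSpace ℝ (Fin n) → ℝ, ContDiffOn ℝ (d + 1 : ℕ) f (closedBall 0 1) →
      (∀ z ∈ Z, f z = 0) → Mder n 0 f = 1 → c ≤ Mder n (d + 1) f) :
    c ≤ RG n d Z := by
  obtain ⟨f, hf, hfZ, hpos⟩ := hne
  refine le_csInf ⟨_, (Mder n 0 f)⁻¹ • f, ?_, ?_, ?_, rfl⟩ ?_
  · exact_mod_cast hf.const_smul _
  · intro z hz
    simp [hfZ z hz]
  · rw [Mder_const_smul (hf.of_le (by norm_cast; omega)) (inv_nonneg.2 hpos.le),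
      inv_mul_cancel₀ hpos.ne']
  · rintro _ ⟨g, hg, hgZ, hg0, rfl⟩
    exact h g (by exact_mod_cast hg) hgZ hg0

end Remez

section Correction

variable {n d : ℕ}

/-- A smooth bump function supported in the unit ball, with value one at the origin. -/
noncomputable def unitBump (n : ℕ) : ContDiffBump (0 : EuclideanSpace ℝ (Fin n)) :=
  ⟨1 / 2, 1, by norm_num, by norm_num⟩

lemma unitBump_zero : unitBump n 0 = 1 :=
  (unitBump n).one_of_mem_closedBall (by simp [unitBump])

lemma unitBump_eq_zero {x : EuclideanSpace ℝ (Fin n)} (hx : 1 ≤ ‖x‖) : unitBump n x = 0 :=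
  (unitBump n).zero_of_le_dist (by simpa [unitBump] using hx)

lemma iteratedFDeriv_unitBump_eq_zero (l : ℕ) {x : EuclideanSpace ℝ (Fin n)} (hx : 1 < ‖x‖) :
    iteratedFDeriv ℝ l (unitBump n) x = 0 := by
  by_contra h
  have := support_iteratedFDeriv_subset (𝕜 := ℝ) (f := unitBump n) l (Function.mem_support.2 h)
  rw [(unitBump n).tsupport_eq] at this
  have : ‖x‖ ≤ 1 := by simpa [unitBump] using this
  linarith

lemma exists_sum_abs_iteratedFDeriv_unitBump_le (n l : ℕ) : ∃ K : ℝ, 0 < K ∧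
    ∀ x : EuclideanSpace ℝ (Fin n), ∑ m : Fin l → Fin n,
      |iteratedFDeriv ℝ l (unitBump n) x (fun i => EuclideanSpace.single (m i) 1)| ≤ K := by
  have hcont : Continuous fun x : EuclideanSpace ℝ (Fin n) => ∑ m : Fin l → Fin n,
      |iteratedFDeriv ℝ l (unitBump n) x (fun i => EuclideanSpace.single (m i) 1)| := by
    have h1 := (unitBump n).contDiff.continuous_iteratedFDeriv (m := l) (n := (l : ℕ∞)) le_rfl
    refine continuous_finsetSum _ fun m _ => Continuous.abs ?_
    exact (ContinuousMultilinearMap.apply ℝ _ ℝ _).continuous.comp h1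
  obtain ⟨c, hc⟩ := (isCompact_closedBall (0 : EuclideanSpace ℝ (Fin n)) 1).bddAbove_image
    hcont.continuousOn
  refine ⟨max c 1, by positivity, fun x => ?_⟩
  rcases le_or_gt ‖x‖ 1 with h | h
  · exact (hc ⟨x, by simpa using h, rfl⟩).trans (le_max_left _ _)
  · simp [iteratedFDeriv_unitBump_eq_zero l h]

/-- The function obtained from `P` by subtracting bumps of radius `c⁻¹` so as to vanish on `Z`. -/
noncomputable def corrected (P : MvPolynomial (Fin n) ℝ) (Z : Finset (EuclideanSpace ℝ (Fin n)))
    (c : ℝ) (x : EuclideanSpace ℝ (Fin n)) : ℝ :=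
  polyFun P x - ∑ z ∈ Z, polyFun P z • unitBump n (c • (x - z))

lemma contDiff_scaledBump (c : ℝ) (z : EuclideanSpace ℝ (Fin n)) {k : ℕ} :
    ContDiff ℝ k fun x => unitBump n (c • (x - z)) :=
  (unitBump n).contDiff.comp ((contDiff_id.sub contDiff_const).const_smul c)

lemma contDiff_corrected (P : MvPolynomial (Fin n) ℝ) (Z : Finset (EuclideanSpace ℝ (Fin n)))
    (c : ℝ) {k : ℕ} : ContDiff ℝ k (corrected P Z c) :=
  (contDiff_polyFun P).sub (ContDiff.sum fun z _ => (contDiff_scaledBump c z).const_smul _)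

lemma iteratedFDeriv_scaledBump (c : ℝ) (z x : EuclideanSpace ℝ (Fin n)) (l : ℕ) :
    iteratedFDeriv ℝ l (fun x => unitBump n (c • (x - z))) x =
      c ^ l • iteratedFDeriv ℝ l (unitBump n) (c • (x - z)) := by
  rw [iteratedFDeriv_comp_sub (f := fun y => unitBump n (c • y)),
    iteratedFDeriv_comp_const_smul c (unitBump n).contDiff]

lemma iteratedFDeriv_corrected {P : MvPolynomial (Fin n) ℝ} (hP : P.totalDegree ≤ d)
    (Z : Finset (EuclideanSpace ℝ (Fin n))) (c : ℝ) (x : EuclideanSpace ℝ (Fin n)) :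
    iteratedFDeriv ℝ (d + 1) (corrected P Z c) x = -∑ z ∈ Z,
      (polyFun P z * c ^ (d + 1)) • iteratedFDeriv ℝ (d + 1) (unitBump n) (c • (x - z)) := by
  have hb : ∀ z ∈ Z, ContDiff ℝ (d + 1 : ℕ) fun x => polyFun P z • unitBump n (c • (x - z)) :=
    fun z _ => (contDiff_scaledBump c z).const_smul _
  change iteratedFDeriv ℝ (d + 1)
    (fun x => polyFun P x - ∑ z ∈ Z, polyFun P z • unitBump n (c • (x - z))) x = _
  rw [fun_iteratedFDeriv_sub_apply (contDiff_polyFun P).contDiffAt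
    (ContDiff.sum hb).contDiffAt, iteratedFDeriv_polyFun_eq_zero hP, zero_sub,
    iteratedFDeriv_fun_sum_apply fun z hz => (hb z hz).contDiffAt]
  congr 1
  refine Finset.sum_congr rfl fun z _ => ?_
  rw [iteratedFDeriv_const_smul_apply' (contDiff_scaledBump c z).contDiffAt,
    iteratedFDeriv_scaledBump, smul_smul]

variable {Z : Finset (EuclideanSpace ℝ (Fin n))} {ρ : ℝ}

lemma eq_of_norm_smul_sub_le_one (hρ : 0 < ρ) (hsep : ∀ x ∈ Z, ∀ y ∈ Z, x ≠ y → ρ ≤ dist x y)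
    {x y z : EuclideanSpace ℝ (Fin n)} (hy : y ∈ Z) (hz : z ∈ Z)
    (h1 : ‖(4 / ρ) • (x - y)‖ ≤ 1) (h2 : ‖(4 / ρ) • (x - z)‖ ≤ 1) : y = z := by
  by_contra hne
  have key : ∀ w : EuclideanSpace ℝ (Fin n), ‖(4 / ρ) • (x - w)‖ ≤ 1 → dist x w ≤ ρ / 4 := by
    intro w hw
    rw [norm_smul, Real.norm_of_nonneg (by positivity), ← dist_eq_norm,
      div_mul_eq_mul_div, div_le_one hρ] at hw
    linarith
  have := dist_triangle_left y z x
  linarith [hsep y hy z hz hne, key y h1, key z h2]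

lemma one_lt_norm_smul_sub (hρ : 0 < ρ) (hsep : ∀ x ∈ Z, ∀ y ∈ Z, x ≠ y → ρ ≤ dist x y)
    {x y z : EuclideanSpace ℝ (Fin n)} (hy : y ∈ Z) (hz : z ∈ Z)
    (h1 : ‖(4 / ρ) • (x - y)‖ ≤ 1) (hne : z ≠ y) : 1 < ‖(4 / ρ) • (x - z)‖ := by
  by_contra! h
  exact hne (eq_of_norm_smul_sub_le_one hρ hsep hz hy h h1)

/-- At most one bump is active at each point. -/
lemma sum_bumps_le (hρ : 0 < ρ) (hsep : ∀ x ∈ Z, ∀ y ∈ Z, x ≠ y → ρ ≤ dist x y)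
    {F : EuclideanSpace ℝ (Fin n) → ℝ} {x : EuclideanSpace ℝ (Fin n)} {K : ℝ} (hK : 0 ≤ K)
    (hF : ∀ z ∈ Z, F z ≤ K) (hF0 : ∀ z ∈ Z, 1 < ‖(4 / ρ) • (x - z)‖ → F z = 0) :
    ∑ z ∈ Z, F z ≤ K := by
  by_cases h : ∃ y ∈ Z, ‖(4 / ρ) • (x - y)‖ ≤ 1
  · obtain ⟨y, hy, hxy⟩ := h
    rw [Finset.sum_eq_single_of_mem y hy fun z hz hne =>
      hF0 z hz (one_lt_norm_smul_sub hρ hsep hy hz hxy hne)]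
    exact hF y hy
  · push Not at h
    rw [Finset.sum_eq_zero fun z hz => hF0 z hz (h z hz)]
    exact hK

lemma corrected_eq_zero (hρ : 0 < ρ) (hsep : ∀ x ∈ Z, ∀ y ∈ Z, x ≠ y → ρ ≤ dist x y)
    (P : MvPolynomial (Fin n) ℝ) {z : EuclideanSpace ℝ (Fin n)} (hz : z ∈ Z) :
    corrected P Z (4 / ρ) z = 0 := by
  rw [corrected, Finset.sum_eq_single_of_mem z hz]
  · simp [unitBump_zero]
  · intro y hy hne
    rw [unitBump_eq_zero (one_lt_norm_smul_sub hρ hsep hz hy (by simp) hne).le, smul_zero]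

lemma abs_polyFun_le_Mder_corrected (hρ : 0 < ρ)
    (hsep : ∀ x ∈ Z, ∀ y ∈ Z, x ≠ y → ρ ≤ dist x y) (P : MvPolynomial (Fin n) ℝ)
    {x : EuclideanSpace ℝ (Fin n)} (hx : x ∈ closedBall (0 : EuclideanSpace ℝ (Fin n)) 1) :
    |polyFun P x| ≤ Mder n 0 (corrected P Z (4 / ρ)) + supPoly n Z P := by
  have h1 := sumPartials_le_Mder (l := 0) (contDiff_corrected P Z (4 / ρ)).contDiffOn hx
  rw [sumPartials_zero] at h1
  have h2 : |∑ z ∈ Z, polyFun P z • unitBump n ((4 / ρ) • (x - z))| ≤ supPoly n Z P := by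
    refine (Finset.abs_sum_le_sum_abs _ _).trans
      (sum_bumps_le (x := x) hρ hsep (supPoly_nonneg _ _) (fun z hz => ?_) fun z _ h => ?_)
    · rw [smul_eq_mul, abs_mul, abs_of_nonneg (unitBump n).nonneg]
      exact (mul_le_of_le_one_right (abs_nonneg _) (unitBump n).le_one).trans
        (abs_polyFun_le_supPoly Z.finite_toSet.isCompact P hz)
    · rw [unitBump_eq_zero h.le, smul_zero, abs_zero]
  have h3 := abs_add_le (corrected P Z (4 / ρ) x)
    (∑ z ∈ Z, polyFun P z • unitBump n ((4 / ρ) • (x - z)))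
  rw [corrected, sub_add_cancel] at h3
  rw [corrected] at h1
  linarith

lemma Mder_corrected_le {K : ℝ} (hK : 0 < K)
    (hbump : ∀ x : EuclideanSpace ℝ (Fin n), ∑ m : Fin (d + 1) → Fin n,
      |iteratedFDeriv ℝ (d + 1) (unitBump n) x (fun i => EuclideanSpace.single (m i) 1)| ≤ K)
    (hρ : 0 < ρ) (hsep : ∀ x ∈ Z, ∀ y ∈ Z, x ≠ y → ρ ≤ dist x y)
    {P : MvPolynomial (Fin n) ℝ} (hP : P.totalDegree ≤ d) :
    Mder n (d + 1) (corrected P Z (4 / ρ)) ≤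
      4 ^ (d + 1) * K / ρ ^ (d + 1) * supPoly n Z P := by
  have hS := supPoly_nonneg (Z : Set (EuclideanSpace ℝ (Fin n))) P
  refine Mder_le (by positivity) fun x hx => ?_
  unfold sumPartials
  rw [iteratedFDerivWithin_eq_iteratedFDeriv uniqueDiffOn_unitClosedBall
    (contDiff_corrected P Z _).contDiffAt hx, iteratedFDeriv_corrected hP]
  have hterm : ∀ m : Fin (d + 1) → Fin n,
      |(-∑ z ∈ Z, (polyFun P z * (4 / ρ) ^ (d + 1)) •
        iteratedFDeriv ℝ (d + 1) (unitBump n) ((4 / ρ) • (x - z)))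
          (fun i => EuclideanSpace.single (m i) 1)| ≤
      ∑ z ∈ Z, |polyFun P z| * (4 / ρ) ^ (d + 1) *
        |iteratedFDeriv ℝ (d + 1) (unitBump n) ((4 / ρ) • (x - z))
          (fun i => EuclideanSpace.single (m i) 1)| := by
    intro m
    rw [neg_apply, abs_neg, sum_apply]
    refine (Finset.abs_sum_le_sum_abs _ _).trans_eq (Finset.sum_congr rfl fun z _ => ?_)
    rw [smul_apply, smul_eq_mul, abs_mul, abs_mul,
      abs_of_nonneg (a := (4 / ρ) ^ (d + 1)) (by positivity)]
  refine (Finset.sum_le_sum fun m _ => hterm m).trans ?_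
  rw [Finset.sum_comm]
  simp_rw [← Finset.mul_sum]
  refine sum_bumps_le (x := x) hρ hsep (by positivity) (fun z hz => ?_) fun z _ h => ?_
  · calc _ ≤ supPoly n Z P * (4 / ρ) ^ (d + 1) * K := by
          gcongr
          · exact abs_polyFun_le_supPoly Z.finite_toSet.isCompact P hz
          · exact hbump _
      _ = _ := by rw [div_pow]; ring
  · simp [iteratedFDeriv_unitBump_eq_zero _ h]

lemma one_le_Mder_corrected_one (hZ : ↑Z ⊆ closedBall (0 : EuclideanSpace ℝ (Fin n)) 1)
    (hρ : 0 < ρ) (hsep : ∀ x ∈ Z, ∀ y ∈ Z, x ≠ y → ρ ≤ dist x y)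
    {x y : EuclideanSpace ℝ (Fin n)} (hx : x ∈ Z) (hy : y ∈ Z) (hxy : dist x y = ρ) :
    1 ≤ Mder n 0 (corrected 1 Z (4 / ρ)) := by
  set w := AffineMap.lineMap x y (1 / 4 : ℝ) with hw
  have hwB : w ∈ closedBall (0 : EuclideanSpace ℝ (Fin n)) 1 :=
    (convex_closedBall 0 1).lineMap_mem (hZ hx) (hZ hy) ⟨by norm_num, by norm_num⟩
  have hwx : dist w x = ρ / 4 := by
    rw [hw, dist_lineMap_left, hxy, Real.norm_of_nonneg (by norm_num)]
    ring
  have hnorm : ∀ z, ‖(4 / ρ) • (w - z)‖ = 4 / ρ * dist w z := fun z => by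
    rw [norm_smul, Real.norm_of_nonneg (by positivity), dist_eq_norm]
  have hx1 : ‖(4 / ρ) • (w - x)‖ = 1 := by
    rw [hnorm, hwx]
    field_simp
  have hval : corrected 1 Z (4 / ρ) w = 1 := by
    rw [corrected, Finset.sum_eq_zero fun z hz => ?_]
    · simp [polyFun]
    · rcases eq_or_ne z x with rfl | hne
      · rw [unitBump_eq_zero hx1.ge, smul_zero]
      · rw [unitBump_eq_zero (one_lt_norm_smul_sub hρ hsep hx hz hx1.le hne).le, smul_zero]
  have h1 := sumPartials_le_Mder (l := 0) (contDiff_corrected 1 Z (4 / ρ)).contDiffOn hwB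
  rwa [sumPartials_zero, hval, abs_one] at h1

end Correction

theorem stmt8 (n d : ℕ) (hn : 1 ≤ n) (hd : 1 ≤ d) :
    ∃ C : ℝ, 0 < C ∧
      ∀ Z : Finset (EuclideanSpace ℝ (Fin n)),
        ↑Z ⊆ closedBall (0 : EuclideanSpace ℝ (Fin n)) 1 →
        ∀ ρ : ℝ,
          IsLeast { r : ℝ | ∃ x ∈ Z, ∃ y ∈ Z, x ≠ y ∧ r = dist x y } ρ →
          ((d + 1).factorial : ℝ) / 2 * hatR n d ↑Z ≤ RG n d ↑Z ∧
            RG n d ↑Z ≤ C / ρ ^ (d + 1) * hatR n d ↑Z := by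
  obtain ⟨K, hK, hbump⟩ := exists_sum_abs_iteratedFDeriv_unitBump_le n (d + 1)
  refine ⟨2 * (4 ^ (d + 1) * K), by positivity, fun Z hZ ρ hleast => ?_⟩
  obtain ⟨⟨x, hx, y, hy, hne, hxy⟩, hmin⟩ := hleast
  have hρ : 0 < ρ := hxy ▸ dist_pos.2 hne
  have hsep : ∀ x ∈ Z, ∀ y ∈ Z, x ≠ y → ρ ≤ dist x y :=
    fun a ha b hb hab => hmin ⟨a, ha, b, hb, hab, rfl⟩
  have hone := one_le_Mder_corrected_one hZ hρ hsep hx hy hxy.symm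
  constructor
  · exact le_RG ⟨corrected 1 Z (4 / ρ), (contDiff_corrected 1 Z _).contDiffOn,
      fun z hz => corrected_eq_zero hρ hsep 1 hz, by linarith⟩
      fun f hf hfZ hf0 => factorial_div_two_mul_hatR_le hZ hf hfZ hf0
  · set A := 4 ^ (d + 1) * K / ρ ^ (d + 1) with hA
    have hA0 : 0 < A := by positivity
    have hC : 2 * (4 ^ (d + 1) * K) / ρ ^ (d + 1) = 2 * A := by rw [hA]; ring
    rw [hC]
    suffices h : RG n d ↑Z / (2 * A) ≤ hatR n d ↑Z by
      rwa [div_le_iff₀' (by positivity)] at h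
    refine le_hatR fun P hP hpos => ?_
    rw [div_le_iff₀' (by positivity)]
    set b := supPoly n (closedBall 0 1) P
    set s := supPoly n (Z : Set (EuclideanSpace ℝ (Fin n))) P
    rcases le_or_gt (s / b) (1 / 2) with h | h
    · rw [div_le_iff₀ hpos] at h
      have hb : b ≤ Mder n 0 (corrected P Z (4 / ρ)) + s :=
        supPoly_le (add_nonneg (Mder_nonneg _ _) (supPoly_nonneg _ _))
          fun x hx => abs_polyFun_le_Mder_corrected hρ hsep P hx
      have hhalf : b / 2 ≤ Mder n 0 (corrected P Z (4 / ρ)) := by linarith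
      calc RG n d ↑Z
          ≤ Mder n (d + 1) (corrected P Z (4 / ρ)) / Mder n 0 (corrected P Z (4 / ρ)) :=
            RG_le (contDiff_corrected P Z _).contDiffOn
              (fun z hz => corrected_eq_zero hρ hsep P hz) (by linarith)
        _ ≤ A * s / (b / 2) :=
            div_le_div₀ (mul_nonneg hA0.le (supPoly_nonneg _ _))
              (Mder_corrected_le hK hbump hρ hsep hP) (by positivity) hhalf
        _ = 2 * A * (s / b) := by ring
    · have hs : supPoly n (Z : Set (EuclideanSpace ℝ (Fin n))) 1 ≤ 1 :=
        supPoly_le zero_le_one fun x _ => by simp [polyFun]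
      calc RG n d ↑Z
          ≤ Mder n (d + 1) (corrected 1 Z (4 / ρ)) / Mder n 0 (corrected 1 Z (4 / ρ)) :=
            RG_le (contDiff_corrected 1 Z _).contDiffOn
              (fun z hz => corrected_eq_zero hρ hsep 1 hz) (by linarith)
        _ ≤ A * 1 / 1 :=
            div_le_div₀ (by positivity)
              ((Mder_corrected_le hK hbump hρ hsep (P := 1) (by simp)).trans (by gcongr))
              one_pos hone
        _ = 2 * A * (1 / 2) := by ring
        _ ≤ 2 * A * (s / b) := by gcongr
end

section
/- Let n, d be positive integers, let Z ⊆ B^n be a Lebesgue-measurable subset of the closed unit ball B^n ⊂ R^n with λ = m_n(Z)/m_n(B^n) > 0, where m_n is Lebesgue measure. Then for every real polynomial P of degree at most d in n variables, sup_{B^n} |P| ≤ (4n/λ)^d · sup_Z |P|. -/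
open Metric MeasureTheory

open Polynomial Polynomial.Chebyshev in
theorem sum_inv_prod_abs_node_sub_node (d : ℕ) :
    ∑ i ∈ Finset.range (d + 1),
      (∏ j ∈ (Finset.range (d + 1)).erase i, |node d i - node d j|)⁻¹ = 2 ^ (d - 1) := by
  have hdeg : (T ℝ d).degree < ((Finset.range (d + 1)).card : WithBot ℕ) := by
    rw [degree_T, Finset.card_range]; norm_cast; simp
  have hcoeff : (T ℝ d).coeff d = 2 ^ (d - 1) := by
    trans (T ℝ d).leadingCoeff
    · simp [leadingCoeff]
    · simp
  have h := Lagrange.coeff_eq_sum (strictAntiOn_node d).injOn hdeg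
  rw [Finset.card_range, Nat.add_sub_cancel, hcoeff] at h
  rw [h]
  refine Finset.sum_congr rfl fun i hi => ?_
  have hid : i ≤ d := Finset.mem_range_succ_iff.mp hi
  have hpos := zero_lt_prod_node_sub_node hid
  rw [eval_T_real_node (Finset.mem_Iic.mpr hid), ← Finset.abs_prod]
  rcases Nat.even_or_odd i with he | ho
  · rw [he.neg_one_pow, one_mul] at hpos
    rw [he.neg_one_pow, abs_of_pos hpos, one_div]
  · rw [ho.neg_one_pow] at hpos
    rw [ho.neg_one_pow, abs_of_neg (by linarith), inv_neg, neg_div, one_div]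

theorem lipschitzWith_volume_inter_Iic {K : Set ℝ} (hK : volume K ≠ ⊤) :
    LipschitzWith 1 fun x => volume.real (K ∩ Set.Iic x) := by
  have hfin : ∀ s, volume (K ∩ s) ≠ ⊤ := fun s =>
    measure_ne_top_of_subset Set.inter_subset_left hK
  refine LipschitzWith.of_le_add fun x y => ?_
  have hsub : K ∩ Set.Iic x ⊆ (K ∩ Set.Iic y) ∪ Set.Ioc y x := by
    intro t ht
    by_cases h : t ≤ y
    · exact Or.inl ⟨ht.1, h⟩
    · exact Or.inr ⟨not_le.mp h, ht.2⟩
  calc volume.real (K ∩ Set.Iic x)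
      ≤ volume.real ((K ∩ Set.Iic y) ∪ Set.Ioc y x) :=
        measureReal_mono hsub (measure_union_ne_top (hfin _) (by simp))
    _ ≤ volume.real (K ∩ Set.Iic y) + volume.real (Set.Ioc y x) := measureReal_union_le _ _
    _ ≤ volume.real (K ∩ Set.Iic y) + dist x y := by
        rw [Real.volume_real_Ioc, Real.dist_eq]
        gcongr
        exact max_le (le_abs_self _) (abs_nonneg _)

/-- A compact set of positive length contains a point splitting its length in any ratio. -/
theorem exists_mem_volume_inter_Iic_eq {K : Set ℝ} (hK : IsCompact K)
    (hpos : 0 < volume.real K) {a : ℝ} (ha : a ∈ Set.Icc 0 (volume.real K)) :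
    ∃ x ∈ K, volume.real (K ∩ Set.Iic x) = a := by
  have hne : K.Nonempty := by
    rw [Set.nonempty_iff_ne_empty]; rintro rfl; simp at hpos
  obtain ⟨l, hlK, hl⟩ := hK.exists_isLeast hne
  obtain ⟨r, hrK, hr⟩ := hK.exists_isGreatest hne
  have hl0 : volume.real (K ∩ Set.Iic l) = 0 := by
    have : K ∩ Set.Iic l ⊆ {l} := fun x hx => le_antisymm hx.2 (hl hx.1)
    rw [measureReal_def, measure_mono_null this (by simp)]; rfl
  have hr1 : volume.real (K ∩ Set.Iic r) = volume.real K := by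
    congr 1; exact Set.inter_eq_left.mpr hr
  obtain ⟨y, hy, hya⟩ := intermediate_value_Icc (hl hrK)
    (lipschitzWith_volume_inter_Iic hK.measure_ne_top).continuous.continuousOn
    (show a ∈ Set.Icc _ _ by simpa only [hl0, hr1] using ha)
  obtain ⟨x, ⟨hxK, hxy⟩, hx⟩ := (hK.inter_right isClosed_Iic).exists_isGreatest
    (⟨l, hlK, hy.1⟩ : (K ∩ Set.Iic y).Nonempty)
  refine ⟨x, hxK, ?_⟩
  rw [← hya]
  congr 1
  ext t
  exact ⟨fun h => ⟨h.1, Set.Iic_subset_Iic.mpr hxy h.2⟩, fun h => ⟨h.1, hx h⟩⟩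

open Polynomial Polynomial.Chebyshev in
/-- A Remez-type inequality at an endpoint of the interval. -/
theorem abs_eval_zero_le_of_forall_mem_compact {d : ℕ} (hd : 1 ≤ d) {q : ℝ[X]}
    (hq : q.natDegree ≤ d) {K : Set ℝ} (hK : IsCompact K) (hpos : 0 < volume.real K)
    {R M : ℝ} (hKR : K ⊆ Set.Icc 0 R) (hM : ∀ t ∈ K, |q.eval t| ≤ M) :
    |q.eval 0| ≤ 1 / 2 * (4 * R / volume.real K) ^ d * M := by
  set m := volume.real K with hm
  have hnode : ∀ i, m / 2 * (1 + node d i) ∈ Set.Icc 0 m := fun i => by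
    have := node_mem_Icc (n := d) (i := i)
    constructor <;> nlinarith [this.1, this.2]
  choose x hxK hx using fun i => exists_mem_volume_inter_Iic_eq hK hpos (hnode i)
  have hdist : ∀ i j, m / 2 * |node d i - node d j| ≤ |x i - x j| := fun i j => by
    have := (lipschitzWith_volume_inter_Iic hK.measure_ne_top).dist_le_mul (x i) (x j)
    rwa [NNReal.coe_one, one_mul, Real.dist_eq, Real.dist_eq, hx, hx, ← mul_sub, abs_mul, abs_of_pos (half_pos hpos), add_sub_add_left_eq_sub] at this
  have hnode_ne : ∀ i ∈ Finset.range (d + 1), ∀ j ∈ Finset.range (d + 1), i ≠ j →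
      0 < |node d i - node d j| := fun i hi j hj hij =>
    abs_pos.mpr (sub_ne_zero.mpr fun h => hij ((strictAntiOn_node d).injOn hi hj h))
  have hinj : Set.InjOn x (Finset.range (d + 1)) := fun i hi j hj hij => by
    by_contra hne
    have h1 := hdist i j
    rw [hij, sub_self, abs_zero] at h1
    have := mul_pos (half_pos hpos) (hnode_ne i hi j hj hne)
    linarith
  have hqdeg : q.degree < ((Finset.range (d + 1)).card : WithBot ℕ) := by
    rw [Finset.card_range]
    exact (natDegree_le_iff_degree_le.mp hq).trans_lt (by norm_cast; simp)
  have hM0 : 0 ≤ M := (abs_nonneg _).trans (hM _ (hxK 0))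
  have hR0 : 0 ≤ R := (hKR (hxK 0)).1.trans (hKR (hxK 0)).2
  rw [Lagrange.eq_interpolate hinj hqdeg, Lagrange.interpolate_apply, eval_finsetSum]
  calc _ ≤ ∑ i ∈ Finset.range (d + 1), |eval 0 (C (eval (x i) q) *
            Lagrange.basis (Finset.range (d + 1)) x i)| := Finset.abs_sum_le_sum_abs _ _
    _ ≤ ∑ i ∈ Finset.range (d + 1), M * ((2 * R / m) ^ d *
          (∏ j ∈ (Finset.range (d + 1)).erase i, |node d i - node d j|)⁻¹) := by
        refine Finset.sum_le_sum fun i hi => ?_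
        rw [eval_mul, eval_C, abs_mul]
        refine mul_le_mul (hM _ (hxK i)) ?_ (abs_nonneg _) hM0
        rw [Lagrange.basis, eval_prod, Finset.abs_prod]
        have hcard : ((Finset.range (d + 1)).erase i).card = d := by
          rw [Finset.card_erase_of_mem hi, Finset.card_range, Nat.add_sub_cancel]
        have : (2 * R / m) ^ d = ∏ j ∈ (Finset.range (d + 1)).erase i, (2 * R / m) := by
          rw [Finset.prod_const, hcard]
        rw [this, ← Finset.prod_inv_distrib, ← Finset.prod_mul_distrib]
        refine Finset.prod_le_prod (fun _ _ => abs_nonneg _) fun j hj => ?_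
        have hji := Finset.mem_erase.mp hj
        have hp := hnode_ne i hi j hji.2 (Ne.symm hji.1)
        have hp' := mul_pos (half_pos hpos) hp
        simp only [Lagrange.basisDivisor, eval_mul, eval_C, eval_sub, eval_X, zero_sub]
        rw [abs_mul, abs_inv, abs_neg, abs_of_nonneg (hKR (hxK j)).1]
        calc |x i - x j|⁻¹ * x j ≤ (m / 2 * |node d i - node d j|)⁻¹ * R := by
              gcongr
              · exact (hKR (hxK j)).1
              · exact hdist i j
              · exact (hKR (hxK j)).2
          _ = 2 * R / m * |node d i - node d j|⁻¹ := by field_simp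
    _ = 1 / 2 * (4 * R / m) ^ d * M := by
        rw [← Finset.mul_sum, ← Finset.mul_sum, sum_inv_prod_abs_node_sub_node]
        obtain ⟨k, rfl⟩ := Nat.exists_eq_add_of_le' hd
        rw [show 4 * R / m = 2 * R / m * 2 by ring, mul_pow, Nat.add_sub_cancel, pow_succ (2 : ℝ) k]
        ring

open Measure in
theorem measure_eq_lintegral_volumeIoiPow_ray {E : Type*} [NormedAddCommGroup E]
    [NormedSpace ℝ E] [FiniteDimensional ℝ E] [Nontrivial E] [MeasurableSpace E] [BorelSpace E]
    (μ : Measure E) [μ.IsAddHaarMeasure] {A : Set E} (hA : MeasurableSet A) :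
    μ A = ∫⁻ u : sphere (0 : E) 1, volumeIoiPow (Module.finrank ℝ E - 1)
      {t | t.1 • u.1 ∈ A} ∂μ.toSphere := by
  have hs : MeasurableSet ((homeomorphUnitSphereProd E).symm ⁻¹'
      ((↑) ⁻¹' A : Set ({0}ᶜ : Set E))) :=
    (homeomorphUnitSphereProd E).symm.measurable (measurable_subtype_coe hA)
  have h := (μ.measurePreserving_homeomorphUnitSphereProd).measure_preimage hs.nullMeasurableSet
  rw [← Set.preimage_comp, Homeomorph.symm_comp_self, Set.preimage_id,
    comap_apply _ Subtype.val_injective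
      (fun s hs => (measurableSet_singleton 0).compl.subtype_image hs) _
      (measurable_subtype_coe hA), Subtype.image_preimage_coe, prod_apply hs] at h
  rw [Set.inter_comm, ← Set.sdiff_eq, measure_sdiff_null (measure_singleton _)] at h
  exact h

open Measure in
/-- If `A` occupies more than a proportion `c` of a set `B` that is star-shaped about `0`, then some
segment of `B` issued from `0` meets `A` in a proportion larger than `c / dim E`. -/
theorem exists_ray_volume_gt {E : Type*} [NormedAddCommGroup E]
    [NormedSpace ℝ E] [FiniteDimensional ℝ E] [Nontrivial E] [MeasurableSpace E] [BorelSpace E]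
    (μ : Measure E) [μ.IsAddHaarMeasure] {A B : Set E} (hA : MeasurableSet A)
    (hB : MeasurableSet B) (hAB : A ⊆ B) (hstar : StarConvex ℝ 0 B)
    (hbdd : Bornology.IsBounded B) {c : ℝ} (hc : 0 ≤ c) (hlt : ENNReal.ofReal c * μ B < μ A) :
    ∃ (u : E) (R : ℝ), 0 < R ∧ {t : ℝ | 0 < t ∧ t • u ∈ A} ⊆ Set.Icc 0 R ∧
      ENNReal.ofReal (c * R / Module.finrank ℝ E) < volume {t : ℝ | 0 < t ∧ t • u ∈ A} := by
  obtain ⟨k, hk⟩ : ∃ k, Module.finrank ℝ E = k + 1 :=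
    Nat.exists_eq_succ_of_ne_zero Module.finrank_pos.ne'
  have hu : ∃ u : sphere (0 : E) 1, ENNReal.ofReal c * volumeIoiPow k {t | t.1 • u.1 ∈ B} <
      volumeIoiPow k {t | t.1 • u.1 ∈ A} := by
    by_contra! hcon
    refine hlt.not_ge ?_
    rw [measure_eq_lintegral_volumeIoiPow_ray μ hA, measure_eq_lintegral_volumeIoiPow_ray μ hB,
      hk, Nat.add_sub_cancel, ← lintegral_const_mul' _ _ ENNReal.ofReal_ne_top]
    exact lintegral_mono hcon
  obtain ⟨u, hu⟩ := hu
  have hunorm : ‖u.1‖ = 1 := by simp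
  obtain ⟨ρ, hρ⟩ := hbdd.exists_norm_le
  set S : Set ℝ := {t | 0 < t ∧ t • u.1 ∈ B} with hS
  have hSbdd : BddAbove S := ⟨ρ, fun t ht => by
    simpa [norm_smul, hunorm, abs_of_pos ht.1] using hρ _ ht.2⟩
  have hAS : {t : ℝ | 0 < t ∧ t • u.1 ∈ A} ⊆ S := fun t ht => ⟨ht.1, hAB ht.2⟩
  obtain ⟨t₀, ht₀⟩ : {t : Set.Ioi (0 : ℝ) | t.1 • u.1 ∈ A}.Nonempty := by
    rw [Set.nonempty_iff_ne_empty]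
    intro h
    simp [h] at hu
  set R := sSup S with hR
  have hRpos : 0 < R := t₀.2.trans_le (le_csSup hSbdd (hAS ⟨t₀.2, ht₀⟩))
  have hAR : {t : ℝ | 0 < t ∧ t • u.1 ∈ A} ⊆ Set.Icc 0 R := fun t ht =>
    ⟨ht.1.le, le_csSup hSbdd (hAS ht)⟩
  refine ⟨u, R, hRpos, hAR, ?_⟩
  have hlow : ENNReal.ofReal (R ^ (k + 1) / (k + 1)) ≤ volumeIoiPow k {t | t.1 • u.1 ∈ B} := by
    rw [← volumeIoiPow_apply_Iio k ⟨R, hRpos⟩]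
    refine measure_mono fun t ht => ?_
    obtain ⟨s, hs, hts⟩ := exists_lt_of_lt_csSup ⟨_, hAS ⟨t₀.2, ht₀⟩⟩ (show t.1 < sSup S from ht)
    have := hstar.smul_mem hs.2 (div_nonneg (le_of_lt t.2) hs.1.le) ((div_le_one hs.1).mpr hts.le)
    rwa [smul_smul, div_mul_cancel₀ _ hs.1.ne'] at this
  have hmeas : MeasurableSet {t : Set.Ioi (0 : ℝ) | t.1 • u.1 ∈ A} :=
    (by fun_prop : Measurable fun t : Set.Ioi (0 : ℝ) => t.1 • u.1) hA
  have hup : volumeIoiPow k {t | t.1 • u.1 ∈ A} ≤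
      ENNReal.ofReal (R ^ k) * volume {t : ℝ | 0 < t ∧ t • u.1 ∈ A} := by
    have himg : Subtype.val '' {t : Set.Ioi (0 : ℝ) | t.1 • u.1 ∈ A} =
        {t : ℝ | 0 < t ∧ t • u.1 ∈ A} := by
      ext t; simp [and_comm]
    rw [volumeIoiPow, withDensity_apply _ hmeas,
      setLIntegral_subtype measurableSet_Ioi _ fun a : ℝ => ENNReal.ofReal (a ^ k), himg,
      ← setLIntegral_const]
    refine setLIntegral_mono measurable_const fun t ht => ?_
    gcongr
    · exact (hAR ht).1
    · exact (hAR ht).2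
  have hfin : ENNReal.ofReal (R ^ k) * ENNReal.ofReal (c * R / Module.finrank ℝ E) <
      ENNReal.ofReal (R ^ k) * volume {t : ℝ | 0 < t ∧ t • u.1 ∈ A} := by
    refine lt_of_eq_of_lt ?_ ((mul_le_mul_right hlow _).trans_lt (hu.trans_le hup))
    rw [← ENNReal.ofReal_mul (by positivity), ← ENNReal.ofReal_mul hc, hk]
    congr 1
    push_cast
    ring
  exact lt_of_mul_lt_mul_left' hfin

/-- A pointwise Remez-type inequality on convex bodies. -/
theorem abs_eval_le_of_forall_mem_of_volume_gt {n d : ℕ} (hn : 1 ≤ n) (hd : 1 ≤ d)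
    {Z B : Set (EuclideanSpace ℝ (Fin n))} (hZ : MeasurableSet Z) (hB : MeasurableSet B)
    (hconv : Convex ℝ B) (hbdd : Bornology.IsBounded B) (hZB : Z ⊆ B) {c : ℝ} (hc : 0 < c)
    (hlt : ENNReal.ofReal c * volume B < volume Z)
    {P : MvPolynomial (Fin n) ℝ} (hdeg : P.totalDegree ≤ d) {M : ℝ}
    (hM : ∀ z ∈ Z, |MvPolynomial.eval (fun i => z i) P| ≤ M)
    {x : EuclideanSpace ℝ (Fin n)} (hx : x ∈ B) :
    |MvPolynomial.eval (fun i => x i) P| ≤ 1 / 2 * (4 * n / c) ^ d * M := by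
  have : NeZero n := ⟨by omega⟩
  have hn0 : (0 : ℝ) < n := by exact_mod_cast hn
  obtain ⟨u, R, hR, hsub, hvol⟩ := exists_ray_volume_gt volume
    (A := (x + ·) ⁻¹' Z) (B := (x + ·) ⁻¹' B)
    (measurable_const_add x hZ) (measurable_const_add x hB) (Set.preimage_mono hZB)
    (StarConvex.preimage_add_right ((add_zero x).symm ▸ hconv.starConvex hx))
    ((isometry_add_left x).antilipschitz.isBounded_preimage hbdd) hc.le
    (by rwa [measure_preimage_add, measure_preimage_add])
  rw [finrank_euclideanSpace_fin] at hvol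
  have hmeas : MeasurableSet {t : ℝ | 0 < t ∧ t • u ∈ (x + ·) ⁻¹' Z} :=
    measurableSet_Ioi.inter
      ((by fun_prop : Measurable fun t : ℝ => x + t • u) hZ)
  obtain ⟨K, hKsub, hK, hKvol⟩ := hmeas.exists_lt_isCompact hvol
  have hKreal : c * R / n < volume.real K :=
    (ENNReal.ofReal_lt_iff_lt_toReal (by positivity) hK.measure_ne_top).mp hKvol
  have hKpos : 0 < volume.real K := lt_of_le_of_lt (by positivity) hKreal
  set q : Polynomial ℝ :=
    MvPolynomial.aeval (fun i => Polynomial.C (x i) + Polynomial.C (u i) * Polynomial.X) P with hq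
  have hqdeg : q.natDegree ≤ d := by
    simpa using MvPolynomial.aeval_natDegree_le (n := 1) P hdeg _ fun i => by
      compute_degree
  have hqeval : ∀ t : ℝ, q.eval t = MvPolynomial.eval (fun i => (x + t • u) i) P := fun t => by
    rw [hq, ← Polynomial.coe_evalRingHom, MvPolynomial.aeval_def, MvPolynomial.hom_eval₂]
    have : (Polynomial.evalRingHom t).comp (algebraMap ℝ (Polynomial ℝ)) = RingHom.id ℝ := by
      ext; simp
    rw [this, MvPolynomial.eval₂_id]
    refine congrArg (fun f => MvPolynomial.eval f P) (funext fun i => ?_)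
    simp only [Polynomial.coe_evalRingHom, Polynomial.eval_add, Polynomial.eval_mul,
      Polynomial.eval_C, Polynomial.eval_X, PiLp.add_apply, PiLp.smul_apply, smul_eq_mul]
    ring
  have hM0 : 0 ≤ M := by
    obtain ⟨t, ht⟩ : K.Nonempty := by
      rw [Set.nonempty_iff_ne_empty]; rintro rfl; simp at hKpos
    exact (abs_nonneg _).trans (hM _ (hKsub ht).2)
  have := abs_eval_zero_le_of_forall_mem_compact hd hqdeg hK hKpos (hKsub.trans hsub) (M := M)
    fun t ht => by rw [hqeval]; exact hM _ (hKsub ht).2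
  rw [hqeval, zero_smul, add_zero] at this
  refine this.trans ?_
  gcongr 1 / 2 * ?_ ^ d * M
  rw [div_le_div_iff₀ hKpos hc]
  rw [div_lt_iff₀ hn0] at hKreal
  linarith

theorem stmt10 (n d : ℕ) (hn : 1 ≤ n) (hd : 1 ≤ d)
    (Z : Set (EuclideanSpace ℝ (Fin n))) (hZmeas : MeasurableSet Z)
    (hZsub : Z ⊆ closedBall 0 1)
    (lam : ℝ)
    (hlam : lam = (volume Z).toReal /
      (volume (closedBall (0 : EuclideanSpace ℝ (Fin n)) 1)).toReal)
    (hlampos : 0 < lam)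
    (P : MvPolynomial (Fin n) ℝ) (hdeg : P.totalDegree ≤ d) :
    (⨆ x ∈ closedBall (0 : EuclideanSpace ℝ (Fin n)) 1,
        |MvPolynomial.eval (fun i => x i) P|) ≤
      (4 * n / lam) ^ d * ⨆ z ∈ Z, |MvPolynomial.eval (fun i => z i) P| := by
  set B := closedBall (0 : EuclideanSpace ℝ (Fin n)) 1 with hB
  set M := ⨆ z ∈ Z, |MvPolynomial.eval (fun i => z i) P| with hMdef
  have hM0 : 0 ≤ M := Real.iSup_nonneg fun z => Real.iSup_nonneg fun _ => abs_nonneg _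
  have hcont : Continuous fun z : EuclideanSpace ℝ (Fin n) =>
      |MvPolynomial.eval (fun i => z i) P| :=
    ((MvPolynomial.continuous_eval P).comp (by fun_prop)).abs
  obtain ⟨C, hC⟩ := (isCompact_closedBall (0 : EuclideanSpace ℝ (Fin n)) 1).bddAbove_image
    hcont.continuousOn
  have hM : ∀ z ∈ Z, |MvPolynomial.eval (fun i => z i) P| ≤ M := fun z hz => by
    have hbdd : BddAbove (Set.range fun z : EuclideanSpace ℝ (Fin n) =>
        ⨆ (_ : z ∈ Z), |MvPolynomial.eval (fun i => z i) P|) := by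
      refine ⟨max C 0, ?_⟩
      rintro _ ⟨w, rfl⟩
      exact Real.iSup_le (fun hw => le_max_of_le_left (hC ⟨w, hZsub hw, rfl⟩)) (le_max_right _ _)
    have h := le_ciSup hbdd z
    rwa [ciSup_pos hz] at h
  have hBtop : volume B ≠ ⊤ := measure_closedBall_lt_top.ne
  have hZtop : volume Z ≠ ⊤ := measure_ne_top_of_subset hZsub hBtop
  have hBpos : 0 < (volume B).toReal :=
    ENNReal.toReal_pos (measure_closedBall_pos _ _ one_pos).ne' hBtop
  obtain ⟨ρ, hρ0, hρ⟩ : ∃ ρ : ℝ, 0 < ρ ∧ ρ ^ d = 1 / 2 :=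
    ⟨(1 / 2) ^ (1 / (d : ℝ)), by positivity, by
      rw [one_div (d : ℝ), Real.rpow_inv_natCast_pow (by norm_num) (by omega)]⟩
  have hρ1 : ρ < 1 := by
    by_contra! h
    linarith [one_le_pow₀ h (n := d)]
  have hlt : ENNReal.ofReal (ρ * lam) * volume B < volume Z := by
    rw [← ENNReal.ofReal_toReal hBtop, ← ENNReal.ofReal_toReal hZtop,
      ← ENNReal.ofReal_mul (by positivity)]
    rw [eq_div_iff hBpos.ne'] at hlam
    rw [← hlam, ENNReal.ofReal_lt_ofReal_iff (by positivity)]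
    nlinarith [mul_pos hlampos hBpos]
  refine Real.iSup_le (fun x => Real.iSup_le (fun hx => ?_) (by positivity)) (by positivity)
  refine (abs_eval_le_of_forall_mem_of_volume_gt hn hd hZmeas isClosed_closedBall.measurableSet
    (convex_closedBall _ _) isBounded_closedBall hZsub (mul_pos hρ0 hlampos) hlt hdeg hM
    hx).trans_eq ?_
  rw [div_pow, mul_pow ρ, hρ, div_pow]
  field_simp
end

section
/- Let n ≥ 1 and let U be a compact connected subset of the closed unit ball B^n ⊂ R^n with non-empty interior and n-dimensional Lebesgue measure μ = m_n(U) > 0, and let Z = ∂U be its boundary. Then every real polynomial P of degree at most 1 in n variables satisfies sup_{B^n} |P| ≤ (4n/μ) · sup_Z |P|. -/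
open Metric MeasureTheory

/-- A real polynomial of total degree at most one is an affine function. -/
theorem MvPolynomial.exists_eval_eq_add_inner {n : ℕ} {P : MvPolynomial (Fin n) ℝ}
    (hdeg : P.totalDegree ≤ 1) :
    ∃ (a : ℝ) (v : EuclideanSpace ℝ (Fin n)), ∀ x : EuclideanSpace ℝ (Fin n),
      MvPolynomial.eval (fun i => x i) P = a + inner ℝ v x := by
  have key : ∀ s ⊆ P.support, ∃ (a : ℝ) (v : EuclideanSpace ℝ (Fin n)),
      ∀ x : EuclideanSpace ℝ (Fin n),
      ∑ d ∈ s, P.coeff d * ∏ i, x i ^ d i = a + inner ℝ v x := by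
    intro s
    induction s using Finset.induction_on with
    | empty => exact fun _ => ⟨0, 0, by simp⟩
    | insert d s hd ih =>
      intro hs
      obtain ⟨a, v, h⟩ := ih (fun e he => hs (Finset.mem_insert_of_mem he))
      have hle : d.degree ≤ 1 :=
        (MvPolynomial.le_totalDegree (hs (Finset.mem_insert_self d s))).trans hdeg
      rcases Nat.le_one_iff_eq_zero_or_eq_one.1 hle with h0 | h1
      · obtain rfl := (Finsupp.degree_eq_zero_iff d).1 h0
        refine ⟨P.coeff 0 + a, v, fun x => ?_⟩
        rw [Finset.sum_insert hd, h]
        simp [add_assoc]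
      · obtain ⟨i, rfl⟩ : d ∈ Set.range (fun a : Fin n => Finsupp.single a 1) := by
          rw [Finsupp.range_single_one]; exact h1
        refine ⟨a, v + P.coeff (Finsupp.single i 1) • EuclideanSpace.single i 1, fun x => ?_⟩
        rw [Finset.sum_insert hd, h, Finset.prod_eq_single i]
        · simp [inner_add_left, inner_smul_left, EuclideanSpace.inner_single_left]
          ring
        · intro j _ hj
          simp [hj.symm]
        · simp
  obtain ⟨a, v, h⟩ := key _ subset_rfl
  exact ⟨a, v, fun x => by rw [MvPolynomial.eval_eq', h]⟩

/-- The volume of the unit ball of `EuclideanSpace ℝ (Fin k)`. -/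
noncomputable def unitBallVolume (k : ℕ) : ℝ :=
  √Real.pi ^ k / Real.Gamma (k / 2 + 1)

theorem unitBallVolume_nonneg (k : ℕ) : 0 ≤ unitBallVolume k := by
  have := Real.Gamma_pos_of_pos (show (0 : ℝ) < k / 2 + 1 by positivity)
  unfold unitBallVolume
  positivity

theorem unitBallVolume_add_two (k : ℕ) :
    unitBallVolume (k + 2) = 2 * Real.pi / (k + 2) * unitBallVolume k := by
  have hpos : (0 : ℝ) < k / 2 + 1 := by positivity
  have hG := (Real.Gamma_pos_of_pos hpos).ne'
  have hπ : √Real.pi ^ 2 = Real.pi := Real.sq_sqrt Real.pi_pos.le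
  unfold unitBallVolume
  rw [show (((k + 2 : ℕ) : ℝ) / 2 + 1) = (k / 2 + 1) + 1 by push_cast; ring,
    Real.Gamma_add_one hpos.ne', pow_add, hπ]
  field_simp

theorem unitBallVolume_zero : unitBallVolume 0 = 1 := by
  simp [unitBallVolume]

theorem unitBallVolume_one : unitBallVolume 1 = 2 := by
  have h : Real.Gamma (((1 : ℕ) : ℝ) / 2 + 1) = √Real.pi / 2 := by
    rw [Real.Gamma_add_one (by norm_num)]
    push_cast
    rw [Real.Gamma_one_half_eq]
    ring
  have := Real.sqrt_pos.2 Real.pi_pos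
  rw [unitBallVolume, h]
  field_simp

theorem unitBallVolume_le (k : ℕ) : unitBallVolume (k + 2) ≤ 1.28 * (k + 3) := by
  have hπ := Real.pi_lt_d2
  have hπ0 := Real.pi_pos
  induction k using Nat.twoStepInduction with
  | zero => rw [unitBallVolume_add_two, unitBallVolume_zero]; norm_num; linarith
  | one => rw [unitBallVolume_add_two, unitBallVolume_one]; norm_num; linarith
  | more k ih _ =>
    rw [show k + 2 + 2 = (k + 2) + 2 from rfl, unitBallVolume_add_two (k + 2)]
    have hk : (0 : ℝ) ≤ k := k.cast_nonneg
    push_cast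
    calc 2 * Real.pi / (k + 2 + 2) * unitBallVolume (k + 2)
        ≤ 2 * Real.pi / (k + 2 + 2) * (1.28 * (k + 3)) := by gcongr
      _ ≤ 1.28 * (k + 2 + 3) := by
        rw [div_mul_eq_mul_div, div_le_iff₀ (by positivity)]
        nlinarith [mul_nonneg hk hk]

theorem volume_closedBall_eq_unitBallVolume (k : ℕ) {r : ℝ} (hr : 0 ≤ r) :
    volume (closedBall (0 : EuclideanSpace ℝ (Fin k)) r) =
      ENNReal.ofReal (r ^ k * unitBallVolume k) := by
  rcases k with _ | k
  · rw [volume_euclideanSpace_eq_dirac, Measure.dirac_apply_of_mem (by simpa using hr)]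
    simp [unitBallVolume_zero]
  · rw [EuclideanSpace.volume_closedBall, ENNReal.ofReal_mul (by positivity),
      ENNReal.ofReal_pow hr]
    simp [unitBallVolume]

/-- A unit vector `v` splits Euclidean space, preserving volume and norms, into the coordinate along
`v` and the orthogonal coordinates. -/
theorem exists_measurePreserving_inner {k : ℕ} {v : EuclideanSpace ℝ (Fin (k + 1))}
    (hv : ‖v‖ = 1) :
    ∃ g : EuclideanSpace ℝ (Fin (k + 1)) → ℝ × EuclideanSpace ℝ (Fin k),
      MeasurePreserving g volume volume ∧
      ∀ x, (g x).1 = inner ℝ v x ∧ ‖x‖ ^ 2 = (g x).1 ^ 2 + ‖(g x).2‖ ^ 2 := by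
  obtain ⟨b, hb⟩ := Orthonormal.exists_orthonormalBasis_extension_of_card_eq (𝕜 := ℝ)
    (E := EuclideanSpace ℝ (Fin (k + 1))) (ι := Fin (k + 1)) (by simp)
    (v := fun _ => v) (s := {0}) (by
      refine ⟨fun _ => hv, fun i j hij => (hij (Subsingleton.elim i j)).elim⟩)
  have h0 : b 0 = v := hb 0 rfl
  refine ⟨_, (((MeasurePreserving.id volume).prod
    (PiLp.volume_preserving_toLp (Fin k))).comp
      (volume_preserving_piFinSuccAbove (fun _ : Fin (k + 1) => ℝ) 0)).comp
      ((PiLp.volume_preserving_ofLp (Fin (k + 1))).comp b.measurePreserving_repr), fun x => ?_⟩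
  constructor
  · simp [MeasurableEquiv.piFinSuccAbove, b.repr_apply_apply, h0]
  · rw [← b.repr.norm_map x, EuclideanSpace.real_norm_sq_eq,
      EuclideanSpace.real_norm_sq_eq, Fin.sum_univ_succ]
    simp [MeasurableEquiv.piFinSuccAbove, Fin.tail]

/-- Volume of a subset of the unit ball lying in the slab `c ≤ ⟪v, x⟫ ≤ d`, bounded by that of a
cylinder of radius `r` over the slab. -/
theorem volume_slab_le {k : ℕ} {v : EuclideanSpace ℝ (Fin (k + 1))} (hv : ‖v‖ = 1)
    {U : Set (EuclideanSpace ℝ (Fin (k + 1)))} (hU : U ⊆ closedBall 0 1) {c d r : ℝ}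
    (hcd : c ≤ d) (hr : 0 ≤ r) (hUcd : ∀ x ∈ U, inner ℝ v x ∈ Set.Icc c d)
    (hrt : ∀ t ∈ Set.Icc c d, 1 - t ^ 2 ≤ r ^ 2) :
    (volume U).toReal ≤ (d - c) * (r ^ k * unitBallVolume k) := by
  obtain ⟨g, hg, hgx⟩ := exists_measurePreserving_inner hv
  have hsub : U ⊆ g ⁻¹' (Set.Icc c d ×ˢ closedBall 0 r) := by
    intro x hx
    have hx1 := mem_closedBall_zero_iff.1 (hU hx)
    obtain ⟨h1, h2⟩ := hgx x
    have ht := hUcd x hx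
    refine ⟨h1 ▸ ht, mem_closedBall_zero_iff.2 ?_⟩
    have := hrt _ ht
    rw [h1] at h2
    exact abs_le_of_sq_le_sq' (by nlinarith [norm_nonneg x]) hr |>.2
  have hvol := unitBallVolume_nonneg k
  refine ENNReal.toReal_le_of_le_ofReal
    (mul_nonneg (sub_nonneg.2 hcd) (by positivity)) ((measure_mono hsub).trans_eq ?_)
  rw [hg.measure_preimage (measurableSet_Icc.prod measurableSet_closedBall).nullMeasurableSet,
    Measure.volume_eq_prod, Measure.prod_prod, Real.volume_Icc,
    volume_closedBall_eq_unitBallVolume k hr, ENNReal.ofReal_mul (sub_nonneg.2 hcd)]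

theorem exists_slab_radius (k : ℕ) {c d : ℝ} (hc : -1 ≤ c) (hcd : c ≤ d) (hd : d ≤ 1) :
    ∃ r, 0 ≤ r ∧ (∀ t ∈ Set.Icc c d, 1 - t ^ 2 ≤ r ^ 2) ∧
      (1 + |(c + d) / 2|) * (r ^ k * unitBallVolume k) ≤ 2 * (k + 1) := by
  have hm1 : |(c + d) / 2| ≤ 1 := abs_le.2 ⟨by linarith, by linarith⟩
  have hone : ∀ t ∈ Set.Icc c d, 1 - t ^ 2 ≤ (1 : ℝ) ^ 2 := fun t _ => by nlinarith [sq_nonneg t]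
  rcases k with _ | _ | k
  · exact ⟨1, zero_le_one, hone, by simp [unitBallVolume_zero]; linarith⟩
  · exact ⟨1, zero_le_one, hone, by simp [unitBallVolume_one]; linarith⟩
  suffices ∃ s, 0 ≤ s ∧ s ≤ 1 ∧ (∀ t ∈ Set.Icc c d, 1 - t ^ 2 ≤ s) ∧
      (1 + |(c + d) / 2|) * s ≤ 1.55 by
    obtain ⟨s, hs0, hs1, hst, hs⟩ := this
    have hsq := Real.sq_sqrt hs0
    refine ⟨√s, Real.sqrt_nonneg s, by rwa [hsq], ?_⟩
    have hpow : √s ^ (k + 2) ≤ s := by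
      rw [pow_add, hsq]
      exact mul_le_of_le_one_left hs0 (pow_le_one₀ (Real.sqrt_nonneg s) (Real.sqrt_le_one.2 hs1))
    have hvol := unitBallVolume_nonneg (k + 2)
    have hle := unitBallVolume_le k
    have hk : (0 : ℝ) ≤ k := k.cast_nonneg
    push_cast
    calc (1 + |(c + d) / 2|) * (√s ^ (k + 2) * unitBallVolume (k + 2))
        ≤ (1 + |(c + d) / 2|) * (s * unitBallVolume (k + 2)) := by gcongr
      _ = (1 + |(c + d) / 2|) * s * unitBallVolume (k + 2) := by ring
      _ ≤ 1.55 * (1.28 * (k + 3)) := by gcongr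
      _ ≤ 2 * (k + 1 + 1 + 1) := by linarith
  rcases lt_or_ge 0 c with h | h
  · refine ⟨1 - c ^ 2, by nlinarith, by nlinarith, fun t ht => by nlinarith [ht.1], ?_⟩
    rw [abs_of_nonneg (by linarith)]
    nlinarith [mul_nonneg (show 0 ≤ 1 - c ^ 2 by nlinarith) (show 0 ≤ 1 - d by linarith),
      mul_nonneg h.le (sq_nonneg (c - 0.1547)), sq_nonneg (c - 0.1547)]
  rcases lt_or_ge d 0 with h' | h'
  · refine ⟨1 - d ^ 2, by nlinarith, by nlinarith, fun t ht => by nlinarith [ht.2], ?_⟩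
    rw [abs_of_nonpos (by linarith)]
    nlinarith [mul_nonneg (show 0 ≤ 1 - d ^ 2 by nlinarith) (show 0 ≤ c + 1 by linarith),
      mul_nonneg (neg_nonneg.2 h'.le) (sq_nonneg (d + 0.1547)), sq_nonneg (d + 0.1547)]
  · refine ⟨1, zero_le_one, le_rfl, fun t _ => by nlinarith [sq_nonneg t], ?_⟩
    have : |(c + d) / 2| ≤ 1 / 2 := abs_le.2 ⟨by linarith, by linarith⟩
    linarith

/-- A nonzero linear form attains its maximum over a compact set on the frontier. -/
theorem IsCompact.exists_mem_frontier_inner_isMaxOn {n : ℕ}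
    {U : Set (EuclideanSpace ℝ (Fin n))} (hU : IsCompact U) (hne : U.Nonempty)
    {v : EuclideanSpace ℝ (Fin n)} (hv : v ≠ 0) :
    ∃ z ∈ frontier U, ∀ x ∈ U, inner ℝ v x ≤ inner ℝ v z := by
  obtain ⟨z, hz, hmax⟩ := hU.exists_isMaxOn hne
    (f := fun x => inner ℝ v x) (by fun_prop)
  refine ⟨z, ⟨subset_closure hz, fun hzi => hv ?_⟩, hmax⟩
  have hloc : IsLocalMax (fun x => inner ℝ v x) z :=
    hmax.isLocalMax (mem_interior_iff_mem_nhds.1 hzi)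
  have := hloc.hasFDerivAt_eq_zero (innerSL ℝ v).hasFDerivAt
  simpa using congrArg (fun L => L v) this

theorem MvPolynomial.exists_eval_eq_add_mul_inner {n : ℕ} (hn : 1 ≤ n)
    {P : MvPolynomial (Fin n) ℝ} (hdeg : P.totalDegree ≤ 1) :
    ∃ (a s : ℝ) (v : EuclideanSpace ℝ (Fin n)), 0 ≤ s ∧ ‖v‖ = 1 ∧
      ∀ x : EuclideanSpace ℝ (Fin n),
        MvPolynomial.eval (fun i => x i) P = a + s * inner ℝ v x := by
  obtain ⟨a, w, h⟩ := exists_eval_eq_add_inner hdeg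
  rcases eq_or_ne w 0 with rfl | hw
  · exact ⟨a, 0, EuclideanSpace.single ⟨0, hn⟩ 1, le_rfl, by simp, by simpa using h⟩
  · have hw' := norm_ne_zero_iff.2 hw
    refine ⟨a, ‖w‖, ‖w‖⁻¹ • w, norm_nonneg w, norm_smul_inv_norm hw, fun x => ?_⟩
    rw [h, real_inner_smul_left]
    field_simp

theorem stmt15 (n : ℕ) (hn : 1 ≤ n)
    (U : Set (EuclideanSpace ℝ (Fin n)))
    (hUsub : U ⊆ closedBall 0 1) (hUcomp : IsCompact U) (hUconn : IsConnected U)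
    (hUint : (interior U).Nonempty) (hμ : 0 < (volume U).toReal)
    (P : MvPolynomial (Fin n) ℝ) (hdeg : P.totalDegree ≤ 1) :
    (⨆ x ∈ closedBall (0 : EuclideanSpace ℝ (Fin n)) 1,
        |MvPolynomial.eval (fun i => x i) P|) ≤
      (4 * n / (volume U).toReal) *
        ⨆ z ∈ frontier U, |MvPolynomial.eval (fun i => z i) P| := by
  obtain ⟨a, s, v, hs, hv, hP⟩ := MvPolynomial.exists_eval_eq_add_mul_inner hn hdeg
  simp only [hP]
  have hv0 : v ≠ 0 := fun h => by simp [h] at hv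
  have hbound : ∀ x ∈ closedBall (0 : EuclideanSpace ℝ (Fin n)) 1, |inner ℝ v x| ≤ 1 := by
    intro x hx
    have h1 := abs_real_inner_le_norm v x
    rw [hv, one_mul] at h1
    exact h1.trans (mem_closedBall_zero_iff.1 hx)
  have hval : ∀ x ∈ closedBall (0 : EuclideanSpace ℝ (Fin n)) 1,
      |a + s * inner ℝ v x| ≤ |a| + s := by
    intro x hx
    calc |a + s * inner ℝ v x| ≤ |a| + |s * inner ℝ v x| := abs_add_le _ _
      _ = |a| + s * |inner ℝ v x| := by rw [abs_mul, abs_of_nonneg hs]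
      _ ≤ |a| + s := by
        have := mul_le_of_le_one_right hs (hbound x hx)
        linarith
  have hfr : frontier U ⊆ U := hUcomp.isClosed.frontier_subset
  set M := ⨆ z ∈ frontier U, |a + s * inner ℝ v z|
  have hM0 : 0 ≤ M := Real.iSup_nonneg fun z => Real.iSup_nonneg fun _ => abs_nonneg _
  have hle : ∀ z ∈ frontier U, |a + s * inner ℝ v z| ≤ M := by
    intro z hz
    have hbdd : BddAbove (Set.range fun z => ⨆ _ : z ∈ frontier U, |a + s * inner ℝ v z|) := by
      refine ⟨|a| + s, ?_⟩
      rintro _ ⟨y, rfl⟩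
      exact Real.iSup_le (fun hy => hval y (hUsub (hfr hy))) (by positivity)
    have := le_ciSup hbdd z
    rwa [ciSup_pos hz] at this
  obtain ⟨z₁, hz₁, hmax⟩ := hUcomp.exists_mem_frontier_inner_isMaxOn hUconn.nonempty hv0
  obtain ⟨z₀, hz₀, hmin⟩ :=
    hUcomp.exists_mem_frontier_inner_isMaxOn hUconn.nonempty (neg_ne_zero.2 hv0)
  simp only [inner_neg_left, neg_le_neg_iff] at hmin
  have hM₁ := hle z₁ hz₁
  have hM₀ := hle z₀ hz₀
  have hcd := hmin z₁ (hfr hz₁)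
  have hc := (abs_le.1 (hbound z₀ (hUsub (hfr hz₀)))).1
  have hd := (abs_le.1 (hbound z₁ (hUsub (hfr hz₁)))).2
  have hIcc : ∀ x ∈ U, inner ℝ v x ∈ Set.Icc (inner ℝ v z₀) (inner ℝ v z₁) :=
    fun x hx => ⟨hmin x hx, hmax x hx⟩
  generalize inner ℝ v z₀ = c at *
  generalize inner ℝ v z₁ = d at *
  set μ := (volume U).toReal
  have hkey : (1 + |(c + d) / 2|) * μ ≤ 2 * n * (d - c) := by
    obtain ⟨k, rfl⟩ : ∃ k, n = k + 1 := ⟨n - 1, by omega⟩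
    obtain ⟨r, hr, hrt, hle⟩ := exists_slab_radius k hc hcd hd
    have hvol := volume_slab_le hv hUsub hcd hr hIcc hrt
    push_cast
    calc (1 + |(c + d) / 2|) * μ
        ≤ (1 + |(c + d) / 2|) * ((d - c) * (r ^ k * unitBallVolume k)) := by gcongr
      _ = (d - c) * ((1 + |(c + d) / 2|) * (r ^ k * unitBallVolume k)) := by ring
      _ ≤ (d - c) * (2 * (k + 1)) := mul_le_mul_of_nonneg_left hle (sub_nonneg.2 hcd)
      _ = 2 * (k + 1) * (d - c) := by ring
  have hmid : |a + s * ((c + d) / 2)| + s * ((d - c) / 2) ≤ M := by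
    rw [abs_le] at hM₀ hM₁
    rcases abs_cases (a + s * ((c + d) / 2)) with ⟨h, _⟩ | ⟨h, _⟩ <;> rw [h] <;> linarith
  have ha : |a| ≤ |a + s * ((c + d) / 2)| + s * |(c + d) / 2| := by
    have := abs_sub (a + s * ((c + d) / 2)) (s * ((c + d) / 2))
    rwa [add_sub_cancel_right, abs_mul s, abs_of_nonneg hs] at this
  have hn0 : (1 : ℝ) ≤ n := by exact_mod_cast hn
  have hμn : μ ≤ 4 * n := by nlinarith [abs_nonneg ((c + d) / 2)]
  have hfinal : |a| + s ≤ 4 * n / μ * M := by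
    rw [div_mul_eq_mul_div, le_div_iff₀ hμ]
    calc (|a| + s) * μ
        ≤ |a + s * ((c + d) / 2)| * μ + s * ((1 + |(c + d) / 2|) * μ) := by nlinarith
      _ ≤ |a + s * ((c + d) / 2)| * (4 * n) + s * (2 * n * (d - c)) := by gcongr
      _ = 4 * n * (|a + s * ((c + d) / 2)| + s * ((d - c) / 2)) := by ring
      _ ≤ 4 * n * M := by gcongr
  have hRHS : 0 ≤ 4 * n / μ * M := by positivity
  exact Real.iSup_le (fun x => Real.iSup_le (fun hx => (hval x hx).trans hfinal) hRHS) hRHS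
end
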